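/- arXiv:1612.04713 — 8 statements merged into one kernel-verified Lean document; each statement's English description precedes it below -/
import Mathlib

section
/- Let A be a unital associative ℂ-algebra, ω ∈ ℂ and β := 1 − ω/2. Suppose s, s′, e, e′ ∈ A satisfy the Brauer-algebra relations: s² = 1, s′² = 1, e² = ω·e, e′² = ω·e′, s·e = e·s = e, s′·e′ = e′·s′ = e′, s·s′·s = s′·s·s′, e·e′·e = e, e′·e·e′ = e′, s·e′·e = s′·e, and e′·e·s′ = e′·s. For u ∈ ℂ set ρ(u) := u(u+β)·s − (u+β)·1 + u·e and ρ′(u) := u(u+β)·s′ − (u+β)·1 + u·e′. Then for all u, v ∈ ℂ the Yang–Baxter equation holds: ρ(u)·ρ′(u+v)·ρ(v) = ρ′(v)·ρ(u+v)·ρ′(u). -/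
/-- Yang–Baxter equation for the elements ρ(u) = u(u+β)s − (u+β)·1 + u·e built from
two adjacent generator pairs of the Brauer algebra B_n(ω), β = 1 − ω/2. -/
theorem brauer_yang_baxter
    (A : Type*) [Ring A] [Algebra ℂ A] (ω : ℂ)
    (s s' e e' : A)
    (hs : s * s = 1) (hs' : s' * s' = 1)
    (he : e * e = ω • e) (he' : e' * e' = ω • e')
    (hse : s * e = e) (hes : e * s = e)
    (hs'e' : s' * e' = e') (he's' : e' * s' = e')
    (hbraid : s * s' * s = s' * s * s')
    (hee'e : e * e' * e = e) (he'ee' : e' * e * e' = e')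
    (hse'e : s * e' * e = s' * e) (he'es' : e' * e * s' = e' * s) :
    ∀ u v : ℂ,
      let β : ℂ := 1 - ω / 2
      let ρ : ℂ → A := fun w => (w * (w + β)) • s - (w + β) • (1 : A) + w • e
      let ρ' : ℂ → A := fun w => (w * (w + β)) • s' - (w + β) • (1 : A) + w • e'
      ρ u * ρ' (u + v) * ρ v = ρ' v * ρ (u + v) * ρ' u := by
  have hss'e : s * s' * e = e' * e := by rw [mul_assoc, ← hse'e, ← mul_assoc, ← mul_assoc, hs, one_mul]
  have hs'ee' : s' * e * e' = s * e' := by rw [← hse'e, mul_assoc, mul_assoc, ← mul_assoc e', he'ee']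
  have hee's : e * e' * s = e * s' := by
    rw [mul_assoc, ← he'es', ← mul_assoc, ← mul_assoc, hee'e]
  have hes'e : e * s' * e = e := by rw [mul_assoc, ← hse'e, ← mul_assoc, ← mul_assoc, hes, hee'e]
  have he'se' : e' * s * e' = e' := by rw [← he'es', mul_assoc, hs'e', he'ee']
  have hse's : s * e' * s = s' * e * s' := by
    rw [mul_assoc, ← he'es', ← mul_assoc, ← mul_assoc, hse'e]
  have hes's : e * s' * s = e * e' := by rw [← hee's, mul_assoc, hs, mul_one]
  have he'ss' : e' * s * s' = e' * e := by rw [← he'es', mul_assoc, hs', mul_one]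
  have hs'se' : s' * s * e' = e * e' := by
    rw [mul_assoc, ← hs'ee', ← mul_assoc, ← mul_assoc, hs', one_mul]
  intro u v β ρ ρ'
  simp only [ρ, ρ', mul_add, mul_sub, add_mul, sub_mul, smul_mul_assoc, mul_smul_comm, mul_one,
    one_mul, hs, hs', he, he', hse, hes, hs'e', he's', hbraid, hee'e, he'ee', hse'e, he'es',
    hss'e, hs'ee', hee's, hes'e, he'se', hse's, hes's, he'ss', hs'se', β]
  module
end

section
/- Let A be a unital associative ℂ-algebra, ω ∈ ℂ and β := 1 − ω/2. Suppose s, e ∈ A satisfy s² = 1, e² = ω·e, and s·e = e·s = e. For u ∈ ℂ set ρ(u) := u(u+β)·s − (u+β)·1 + u·e. Then for all u ∈ ℂ the unitarity relation holds: ρ(u)·ρ(−u) = (u² − 1)(u² − β²)·1. -/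
/-- Unitarity relation ρ(u)·ρ(−u) = (u²−1)(u²−β²)·1 for the Yang–Baxter element
ρ(u) = u(u+β)s − (u+β)·1 + u·e built from a Brauer generator pair, β = 1 − ω/2. -/
theorem brauer_unitarity
    (A : Type*) [Ring A] [Algebra ℂ A] (ω : ℂ)
    (s e : A)
    (hs : s * s = 1) (he : e * e = ω • e)
    (hse : s * e = e) (hes : e * s = e) :
    ∀ u : ℂ,
      let β : ℂ := 1 - ω / 2
      let ρ : ℂ → A := fun w => (w * (w + β)) • s - (w + β) • (1 : A) + w • e
      ρ u * ρ (-u) = ((u ^ 2 - 1) * (u ^ 2 - β ^ 2)) • (1 : A) := by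
  intro u β ρ
  simp only [ρ, β, add_mul, sub_mul, mul_add, mul_sub, smul_mul_assoc, mul_smul_comm,
    hs, he, hse, hes, mul_one, one_mul]
  module
end

section
/- With a supermetric as in the context, fix m ≥ 2 and for i = 1, …, m−1 define complex matrices s_i and e_i indexed by functions f, g : Fin m → I as follows: (s_i)^f_g = ε(−1)^{[f(i)][f(i+1)]} if g(i) = f(i+1), g(i+1) = f(i) and g(j) = f(j) for j ≠ i, i+1, and 0 otherwise; (e_i)^f_g = ε̄^{f(i)f(i+1)} ε_{g(i)g(i+1)} · ∏_{j≠i,i+1} δ_{f(j)g(j)}. Then these matrices satisfy all defining relations of the Brauer algebra B_m(ω): s_i² = 1, e_i² = ω·e_i, s_i e_i = e_i s_i = e_i; s_i s_j = s_j s_i, e_i e_j = e_j e_i, s_i e_j = e_j s_i for |i−j| > 1; and s_i s_{i+1} s_i = s_{i+1} s_i s_{i+1}, e_i e_{i+1} e_i = e_i, e_{i+1} e_i e_{i+1} = e_{i+1}, s_i e_{i+1} e_i = s_{i+1} e_i, e_{i+1} e_i s_{i+1} = e_{i+1} s_i. -/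
/-- The sign (−1)^x for a parity x ∈ ZMod 2. -/
noncomputable def sg (x : ZMod 2) : ℂ := if x = 0 then 1 else -1

theorem sg_mul_self (x : ZMod 2) : sg x * sg x = 1 := by
  unfold sg
  split_ifs <;> norm_num

theorem comp_swap_eq_update {K I : Type*} [DecidableEq K] (f : K → I) (a b : K) :
    f ∘ Equiv.swap a b = Function.update (Function.update f a (f b)) b (f a) := by
  funext j
  simp only [Function.comp_apply, Function.update_apply, Equiv.swap_apply_def]
  split_ifs <;> simp_all

theorem update_pair_comm {K I : Type*} [DecidableEq K] {a b c d : K}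
    (hac : a ≠ c) (had : a ≠ d) (hbc : b ≠ c) (hbd : b ≠ d)
    (f : K → I) (w x y z : I) :
    Function.update (Function.update (Function.update (Function.update f a w) b x) c y) d z =
      Function.update (Function.update (Function.update (Function.update f c y) d z) a w) b x := by
  funext j
  simp only [Function.update_apply]
  split_ifs <;> simp_all

theorem sum_pair_comm {I : Type*} [Fintype I] (F : I → I → I → I → ℂ) :
    ∑ w, ∑ x, ∑ y, ∑ z, F w x y z = ∑ y, ∑ z, ∑ w, ∑ x, F w x y z := by
  have h := Finset.sum_comm (s := Finset.univ) (t := Finset.univ)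
    (f := fun u v : I × I => F u.1 u.2 v.1 v.2)
  simpa only [Fintype.sum_prod_type] using h

section BrauerOperators

variable {K I : Type*} [Fintype K] [DecidableEq K] [Fintype I] [DecidableEq I]

/-- The graded flip of the tensor factors at positions `a` and `b`. -/
noncomputable def superFlip (p : I → ZMod 2) (ε : ℂ) (a b : K) :
    Matrix (K → I) (K → I) ℂ :=
  Matrix.of fun f g =>
    if g = f ∘ Equiv.swap a b then ε * sg (p (f a) * p (f b)) else 0

/-- The contraction of the tensor factors at positions `a` and `b` with `lo`, followed by the
insertion of `hi` at these positions. -/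
noncomputable def capCup (lo hi : Matrix I I ℂ) (a b : K) : Matrix (K → I) (K → I) ℂ :=
  Matrix.of fun f g =>
    hi (f a) (f b) * lo (g a) (g b) * (if ∀ j, j ≠ a → j ≠ b → f j = g j then 1 else 0)

theorem superFlip_mulVec (p : I → ZMod 2) (ε : ℂ) (a b : K) (v : (K → I) → ℂ) (f : K → I) :
    (superFlip p ε a b).mulVec v f = ε * sg (p (f a) * p (f b)) *
      v (Function.update (Function.update f a (f b)) b (f a)) := by
  simp [Matrix.mulVec, dotProduct, superFlip, ← comp_swap_eq_update]

theorem capCup_mulVec (lo hi : Matrix I I ℂ) {a b : K} (hab : a ≠ b) (v : (K → I) → ℂ)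
    (f : K → I) :
    (capCup lo hi a b).mulVec v f = hi (f a) (f b) *
      ∑ c, ∑ d, lo c d * v (Function.update (Function.update f a c) b d) := by
  rw [← Fintype.sum_prod_type' (f := fun c d =>
    lo c d * v (Function.update (Function.update f a c) b d)), Finset.mul_sum]
  simp only [Matrix.mulVec, dotProduct, capCup, Matrix.of_apply]
  symm
  refine Finset.sum_of_injOn
    (fun x : I × I => Function.update (Function.update f a x.1) b x.2) ?_ (by simp) ?_ ?_
  · rintro ⟨c, d⟩ - ⟨c', d'⟩ - h
    have ha := congrFun h a
    have hb := congrFun h b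
    simp_all
  · rintro g - hg
    rw [if_neg]
    · simp
    intro h
    refine hg ⟨(g a, g b), by simp, ?_⟩
    funext j
    simp only [Function.update_apply]
    split_ifs <;> simp_all
  · rintro ⟨c, d⟩ -
    rw [if_pos]
    · simp [hab, mul_assoc]
    intro j hja hjb
    simp [hja, hjb]

theorem matrix_eq_of_mulVec_apply {ι : Type*} [Fintype ι] [DecidableEq ι] {A B : Matrix ι ι ℂ}
    (h : ∀ v f, A.mulVec v f = B.mulVec v f) : A = B :=
  Matrix.mulVec_injective (funext fun v => funext (h v))

section SingleSite

variable (p : I → ZMod 2) {ε : ℂ} (lo hi : Matrix I I ℂ) {a b : K}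

theorem superFlip_mul_self (hε : ε * ε = 1) (hab : a ≠ b) :
    superFlip p ε a b * superFlip p ε a b = 1 := by
  refine matrix_eq_of_mulVec_apply fun v f => ?_
  simp only [← Matrix.mulVec_mulVec, superFlip_mulVec, Matrix.one_mulVec]
  have hf : Function.update (Function.update (Function.update (Function.update f a (f b)) b (f a))
      a (f a)) b (f b) = f := by
    funext j
    simp only [Function.update_apply]
    split_ifs <;> simp_all
  simp only [Function.update_self, Function.update_of_ne hab, hf]
  rw [mul_comm (p (f b))]
  linear_combination (v f * sg (p (f a) * p (f b)) ^ 2) * hε + v f * sg_mul_self (p (f a) * p (f b))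

theorem capCup_mul_self (hab : a ≠ b) :
    capCup lo hi a b * capCup lo hi a b = (∑ c, ∑ d, hi c d * lo c d) • capCup lo hi a b := by
  refine matrix_eq_of_mulVec_apply fun v f => ?_
  simp only [← Matrix.mulVec_mulVec, Matrix.smul_mulVec, Pi.smul_apply, smul_eq_mul,
    capCup_mulVec lo hi hab, Function.update_self, Function.update_of_ne hab]
  have hf : ∀ c d c' d', Function.update (Function.update
      (Function.update (Function.update f a c) b d) a c') b d' =
      Function.update (Function.update f a c') b d' := by
    intros
    funext j
    simp only [Function.update_apply]
    split_ifs <;> simp_all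
  simp only [hf, ← mul_assoc, ← Finset.sum_mul]
  simp only [mul_comm (lo _ _) (hi _ _)]
  ring

theorem superFlip_mul_capCup (hhi : ∀ c d, hi c d = ε * sg (p c * p d) * hi d c) (hab : a ≠ b) :
    superFlip p ε a b * capCup lo hi a b = capCup lo hi a b := by
  refine matrix_eq_of_mulVec_apply fun v f => ?_
  simp only [← Matrix.mulVec_mulVec, superFlip_mulVec, capCup_mulVec lo hi hab,
    Function.update_self, Function.update_of_ne hab]
  have hf : ∀ c d, Function.update (Function.update
      (Function.update (Function.update f a (f b)) b (f a)) a c) b d =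
      Function.update (Function.update f a c) b d := by
    intros
    funext j
    simp only [Function.update_apply]
    split_ifs <;> simp_all
  simp only [hf]
  rw [hhi (f a) (f b), mul_assoc (ε * _)]

theorem capCup_mul_superFlip (hlo : ∀ c d, lo c d = ε * sg (p c * p d) * lo d c) (hab : a ≠ b) :
    capCup lo hi a b * superFlip p ε a b = capCup lo hi a b := by
  refine matrix_eq_of_mulVec_apply fun v f => ?_
  simp only [← Matrix.mulVec_mulVec, superFlip_mulVec, capCup_mulVec lo hi hab,
    Function.update_self, Function.update_of_ne hab]
  have hf : ∀ c d, Function.update (Function.update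
      (Function.update (Function.update f a c) b d) a d) b c =
      Function.update (Function.update f a d) b c := by
    intros
    funext j
    simp only [Function.update_apply]
    split_ifs <;> simp_all
  simp only [hf]
  congr 1
  rw [Finset.sum_comm]
  refine Finset.sum_congr rfl fun c _ => Finset.sum_congr rfl fun d _ => ?_
  rw [hlo c d, mul_comm (p c)]
  ring

end SingleSite

section DisjointSites

variable (p : I → ZMod 2) (ε : ℂ) (lo hi : Matrix I I ℂ) {a b c d : K}

theorem superFlip_comm (hac : a ≠ c) (had : a ≠ d) (hbc : b ≠ c) (hbd : b ≠ d) :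
    superFlip p ε a b * superFlip p ε c d = superFlip p ε c d * superFlip p ε a b := by
  refine matrix_eq_of_mulVec_apply fun v f => ?_
  simp only [← Matrix.mulVec_mulVec, superFlip_mulVec, Function.update_of_ne hac,
    Function.update_of_ne had, Function.update_of_ne hbc, Function.update_of_ne hbd,
    Function.update_of_ne hac.symm, Function.update_of_ne had.symm,
    Function.update_of_ne hbc.symm, Function.update_of_ne hbd.symm,
    update_pair_comm hac had hbc hbd]
  ring

theorem capCup_comm (hab : a ≠ b) (hcd : c ≠ d) (hac : a ≠ c) (had : a ≠ d) (hbc : b ≠ c)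
    (hbd : b ≠ d) :
    capCup lo hi a b * capCup lo hi c d = capCup lo hi c d * capCup lo hi a b := by
  refine matrix_eq_of_mulVec_apply fun v f => ?_
  simp only [← Matrix.mulVec_mulVec, capCup_mulVec lo hi hab, capCup_mulVec lo hi hcd,
    Function.update_of_ne hac,
    Function.update_of_ne had, Function.update_of_ne hbc, Function.update_of_ne hbd,
    Function.update_of_ne hac.symm, Function.update_of_ne had.symm,
    Function.update_of_ne hbc.symm, Function.update_of_ne hbd.symm,
    update_pair_comm hac had hbc hbd]
  simp only [Finset.mul_sum]
  rw [sum_pair_comm]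
  refine Finset.sum_congr rfl fun x _ => Finset.sum_congr rfl fun y _ =>
    Finset.sum_congr rfl fun z _ => Finset.sum_congr rfl fun t _ => ?_
  ring

theorem superFlip_capCup_comm (hcd : c ≠ d) (hac : a ≠ c) (had : a ≠ d) (hbc : b ≠ c)
    (hbd : b ≠ d) :
    superFlip p ε a b * capCup lo hi c d = capCup lo hi c d * superFlip p ε a b := by
  refine matrix_eq_of_mulVec_apply fun v f => ?_
  simp only [← Matrix.mulVec_mulVec, superFlip_mulVec, capCup_mulVec lo hi hcd,
    Function.update_of_ne hac,
    Function.update_of_ne had, Function.update_of_ne hbc, Function.update_of_ne hbd,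
    Function.update_of_ne hac.symm, Function.update_of_ne had.symm,
    Function.update_of_ne hbc.symm, Function.update_of_ne hbd.symm,
    update_pair_comm hac had hbc hbd]
  simp only [Finset.mul_sum]
  refine Finset.sum_congr rfl fun x _ => Finset.sum_congr rfl fun y _ => ?_
  ring

end DisjointSites

section AdjacentSites

variable (p : I → ZMod 2) (ε : ℂ) {lo hi : Matrix I I ℂ} {a b c : K}

theorem superFlip_braid (hab : a ≠ b) (hbc : b ≠ c) (hac : a ≠ c) :
    superFlip p ε a b * superFlip p ε b c * superFlip p ε a b =
      superFlip p ε b c * superFlip p ε a b * superFlip p ε b c := by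
  refine matrix_eq_of_mulVec_apply fun v f => ?_
  simp only [← Matrix.mulVec_mulVec, superFlip_mulVec, Function.update_self,
    Function.update_of_ne hac, Function.update_of_ne hab, Function.update_of_ne hbc,
    Function.update_of_ne hac.symm, Function.update_of_ne hbc.symm]
  have hf : Function.update (Function.update (Function.update (Function.update
      (Function.update (Function.update f a (f b)) b (f a)) b (f c)) c (f a)) a (f c)) b (f b) =
      Function.update (Function.update (Function.update (Function.update
      (Function.update (Function.update f b (f c)) c (f b)) a (f c)) b (f a)) b (f b)) c (f a) := by
    funext j
    simp only [Function.update_apply]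
    split_ifs <;> simp_all
  rw [hf]
  ring

theorem sum_lo_mul_hi_left (h : ∀ x z, (∑ y, hi x y * lo y z) = if x = z then 1 else 0)
    (w : I → ℂ) (x : I) : ∑ y, ∑ z, lo y z * (hi x y * w z) = w x := by
  rw [Finset.sum_comm]
  calc _ = ∑ z, (∑ y, hi x y * lo y z) * w z := by
        simp only [Finset.sum_mul]
        refine Finset.sum_congr rfl fun z _ => Finset.sum_congr rfl fun y _ => ?_
        ring
    _ = w x := by simp [h]

theorem sum_lo_mul_hi_right (h : ∀ x z, (∑ y, lo x y * hi y z) = if x = z then 1 else 0)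
    (w : I → ℂ) (z : I) : ∑ x, ∑ y, lo x y * (hi y z * w x) = w z := by
  calc _ = ∑ x, (∑ y, lo x y * hi y z) * w x := by
        simp only [Finset.sum_mul]
        refine Finset.sum_congr rfl fun x _ => Finset.sum_congr rfl fun y _ => ?_
        ring
    _ = w z := by simp [h]

theorem capCup_mul_capCup_mul_capCup
    (h₁ : ∀ x z, (∑ y, hi x y * lo y z) = if x = z then 1 else 0)
    (h₂ : ∀ x z, (∑ y, lo x y * hi y z) = if x = z then 1 else 0)
    (hab : a ≠ b) (hbc : b ≠ c) (hac : a ≠ c) :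
    capCup lo hi a b * capCup lo hi b c * capCup lo hi a b = capCup lo hi a b := by
  refine matrix_eq_of_mulVec_apply fun v f => ?_
  simp only [← Matrix.mulVec_mulVec, capCup_mulVec lo hi hab, capCup_mulVec lo hi hbc,
    Function.update_self,
    Function.update_of_ne hac, Function.update_of_ne hab, Function.update_of_ne hbc,
    Function.update_of_ne hac.symm, Function.update_of_ne hbc.symm]
  have hf : ∀ x y z t q r : I, Function.update (Function.update (Function.update (Function.update
      (Function.update (Function.update f a x) b y) b z) c t) a q) b r =
      Function.update (Function.update (Function.update f c t) a q) b r := by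
    intros
    funext j
    simp only [Function.update_apply]
    split_ifs <;> simp_all
  simp only [hf]
  simp only [sum_lo_mul_hi_left h₁ fun t => ∑ q, ∑ r, lo q r *
    v (Function.update (Function.update (Function.update f c t) a q) b r)]
  rw [sum_lo_mul_hi_right h₂ fun t => ∑ q, ∑ r, lo q r *
    v (Function.update (Function.update (Function.update f c t) a q) b r)]
  simp

theorem capCup_mul_capCup_mul_capCup'
    (h₁ : ∀ x z, (∑ y, hi x y * lo y z) = if x = z then 1 else 0)
    (h₂ : ∀ x z, (∑ y, lo x y * hi y z) = if x = z then 1 else 0)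
    (hab : a ≠ b) (hbc : b ≠ c) (hac : a ≠ c) :
    capCup lo hi b c * capCup lo hi a b * capCup lo hi b c = capCup lo hi b c := by
  refine matrix_eq_of_mulVec_apply fun v f => ?_
  simp only [← Matrix.mulVec_mulVec, capCup_mulVec lo hi hab, capCup_mulVec lo hi hbc,
    Function.update_self,
    Function.update_of_ne hac, Function.update_of_ne hab, Function.update_of_ne hbc,
    Function.update_of_ne hac.symm, Function.update_of_ne hbc.symm]
  have hf : ∀ x y z t q r : I, Function.update (Function.update (Function.update (Function.update
      (Function.update (Function.update f b x) c y) a z) b t) b q) c r =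
      Function.update (Function.update (Function.update f a z) b q) c r := by
    intros
    funext j
    simp only [Function.update_apply]
    split_ifs <;> simp_all
  simp only [hf]
  simp only [sum_lo_mul_hi_right h₂ fun z => ∑ q, ∑ r, lo q r *
    v (Function.update (Function.update (Function.update f a z) b q) c r)]
  rw [sum_lo_mul_hi_left h₁ fun z => ∑ q, ∑ r, lo q r *
    v (Function.update (Function.update (Function.update f a z) b q) c r)]
  simp

theorem superFlip_mul_capCup_mul_capCup
    (hhi : ∀ x y, p x + p y ≠ 0 → hi x y = 0)
    (h₁ : ∀ x z, (∑ y, hi x y * lo y z) = if x = z then 1 else 0)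
    (hab : a ≠ b) (hbc : b ≠ c) (hac : a ≠ c) :
    superFlip p ε a b * capCup lo hi b c * capCup lo hi a b =
      superFlip p ε b c * capCup lo hi a b := by
  refine matrix_eq_of_mulVec_apply fun v f => ?_
  simp only [← Matrix.mulVec_mulVec, superFlip_mulVec, capCup_mulVec lo hi hab,
    capCup_mulVec lo hi hbc, Function.update_self,
    Function.update_of_ne hac, Function.update_of_ne hab, Function.update_of_ne hbc,
    Function.update_of_ne hac.symm, Function.update_of_ne hbc.symm]
  have hf : ∀ z t q r : I, Function.update (Function.update (Function.update (Function.update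
      (Function.update (Function.update f a (f b)) b (f a)) b z) c t) a q) b r =
      Function.update (Function.update (Function.update f c t) a q) b r := by
    intros
    funext j
    simp only [Function.update_apply]
    split_ifs <;> simp_all
  have hf' : ∀ q r : I, Function.update (Function.update (Function.update
      (Function.update f b (f c)) c (f b)) a q) b r =
      Function.update (Function.update (Function.update f c (f b)) a q) b r := by
    intros
    funext j
    simp only [Function.update_apply]
    split_ifs <;> simp_all
  simp only [hf, hf']
  rw [sum_lo_mul_hi_left h₁ fun t => ∑ q, ∑ r, lo q r *
    v (Function.update (Function.update (Function.update f c t) a q) b r)]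
  by_cases h : p (f a) + p (f c) = 0
  · rw [CharTwo.add_eq_zero.mp h, mul_comm (p (f c))]
  · simp [hhi _ _ h]

theorem capCup_mul_capCup_mul_superFlip
    (hlo : ∀ x y, p x + p y ≠ 0 → lo x y = 0)
    (h₁ : ∀ x z, (∑ y, hi x y * lo y z) = if x = z then 1 else 0)
    (hab : a ≠ b) (hbc : b ≠ c) (hac : a ≠ c) :
    capCup lo hi b c * capCup lo hi a b * superFlip p ε b c =
      capCup lo hi b c * superFlip p ε a b := by
  refine matrix_eq_of_mulVec_apply fun v f => ?_
  simp only [← Matrix.mulVec_mulVec, superFlip_mulVec, capCup_mulVec lo hi hab,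
    capCup_mulVec lo hi hbc, Function.update_self,
    Function.update_of_ne hac, Function.update_of_ne hab, Function.update_of_ne hbc,
    Function.update_of_ne hac.symm, Function.update_of_ne hbc.symm]
  have hf : ∀ x y z t : I, Function.update (Function.update (Function.update (Function.update
      (Function.update (Function.update f b x) c y) a z) b t) b y) c t =
      Function.update (Function.update (Function.update f a z) b y) c t := by
    intros
    funext j
    simp only [Function.update_apply]
    split_ifs <;> simp_all
  have hf' : ∀ x y : I, Function.update (Function.update (Function.update
      (Function.update f b x) c y) a x) b (f a) =
      Function.update (Function.update (Function.update f a x) b (f a)) c y := by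
    intros
    funext j
    simp only [Function.update_apply]
    split_ifs <;> simp_all
  simp only [hf, hf']
  rw [sum_lo_mul_hi_left h₁ fun y => ∑ z, ∑ t, lo z t * (ε * sg (p t * p y) *
    v (Function.update (Function.update (Function.update f a z) b y) c t))]
  congr 1
  refine Finset.sum_congr rfl fun z _ => Finset.sum_congr rfl fun t _ => ?_
  by_cases h : p z + p t = 0
  · rw [CharTwo.add_eq_zero.mp h, mul_comm (p t)]
  · simp [hlo _ _ h]

end AdjacentSites

end BrauerOperators

/-- The matrices s_i and e_i built from a supermetric on the superspace satisfy all
defining relations of the Brauer algebra B_m(ω). -/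
theorem brauer_algebra_representation
    (n : ℕ) (p : Fin n → ZMod 2) (ε : ℂ) (hε : ε = 1 ∨ ε = -1)
    (εlo εhi : Matrix (Fin n) (Fin n) ℂ)
    (hlo0 : ∀ a b, p a + p b ≠ 0 → εlo a b = 0)
    (hhi0 : ∀ a b, p a + p b ≠ 0 → εhi a b = 0)
    (hlosym : ∀ a b, εlo a b = ε * sg (p a * p b) * εlo b a)
    (hhisym : ∀ a b, εhi a b = ε * sg (p a * p b) * εhi b a)
    (hinv1 : ∀ a c, (∑ b, εhi a b * εlo b c) = if a = c then 1 else 0)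
    (hinv2 : ∀ a c, (∑ b, εlo a b * εhi b c) = if a = c then 1 else 0)
    (m : ℕ) (hm : 2 ≤ m) :
    let ω : ℂ := ∑ a, ∑ b, εhi a b * εlo a b
    let pos0 : Fin (m - 1) → Fin m := fun i => ⟨i.1, by have := i.2; omega⟩
    let pos1 : Fin (m - 1) → Fin m := fun i => ⟨i.1 + 1, by have := i.2; omega⟩
    let S : Fin (m - 1) → Matrix (Fin m → Fin n) (Fin m → Fin n) ℂ := fun i =>
      Matrix.of fun f g =>
        if g = f ∘ (Equiv.swap (pos0 i) (pos1 i)) then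
          ε * sg (p (f (pos0 i)) * p (f (pos1 i))) else 0
    let E : Fin (m - 1) → Matrix (Fin m → Fin n) (Fin m → Fin n) ℂ := fun i =>
      Matrix.of fun f g =>
        εhi (f (pos0 i)) (f (pos1 i)) * εlo (g (pos0 i)) (g (pos1 i)) *
          (if ∀ j, j ≠ pos0 i → j ≠ pos1 i → f j = g j then 1 else 0)
    (∀ i, S i * S i = 1) ∧
    (∀ i, E i * E i = ω • E i) ∧
    (∀ i, S i * E i = E i ∧ E i * S i = E i) ∧
    (∀ i j : Fin (m - 1), (i.1 + 1 < j.1 ∨ j.1 + 1 < i.1) →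
      S i * S j = S j * S i ∧ E i * E j = E j * E i ∧ S i * E j = E j * S i) ∧
    (∀ i j : Fin (m - 1), j.1 = i.1 + 1 →
      S i * S j * S i = S j * S i * S j ∧
      E i * E j * E i = E i ∧
      E j * E i * E j = E j ∧
      S i * E j * E i = S j * E i ∧
      E j * E i * S j = E j * S i) := by
  have hεε : ε * ε = 1 := by rcases hε with rfl | rfl <;> norm_num
  intro ω pos0 pos1 S E
  have hS : ∀ i, S i = superFlip p ε (pos0 i) (pos1 i) := fun _ => rfl
  have hE : ∀ i, E i = capCup εlo εhi (pos0 i) (pos1 i) := fun i => by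
    ext f g
    simp only [E, capCup, Matrix.of_apply]
    congr
  have h01 : ∀ i, pos0 i ≠ pos1 i := fun i h => by
    have := congrArg Fin.val h
    simp only [pos0, pos1] at this
    omega
  simp only [hS, hE]
  refine ⟨fun i => superFlip_mul_self p hεε (h01 i), fun i => capCup_mul_self εlo εhi (h01 i),
    fun i => ⟨superFlip_mul_capCup p εlo εhi hhisym (h01 i),
      capCup_mul_superFlip p εlo εhi hlosym (h01 i)⟩, fun i j hij => ?_, fun i j hij => ?_⟩
  · have h00 : pos0 i ≠ pos0 j := by simp only [pos0, ne_eq, Fin.mk.injEq]; omega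
    have h0 : pos0 i ≠ pos1 j := by simp only [pos0, pos1, ne_eq, Fin.mk.injEq]; omega
    have h1 : pos1 i ≠ pos0 j := by simp only [pos0, pos1, ne_eq, Fin.mk.injEq]; omega
    have h11 : pos1 i ≠ pos1 j := by simp only [pos1, ne_eq, Fin.mk.injEq]; omega
    exact ⟨superFlip_comm p ε h00 h0 h1 h11,
      capCup_comm εlo εhi (h01 i) (h01 j) h00 h0 h1 h11,
      superFlip_capCup_comm p ε εlo εhi (h01 j) h00 h0 h1 h11⟩
  · have hmid : pos0 j = pos1 i := by simp only [pos0, pos1, Fin.mk.injEq]; omega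
    have hab := h01 i
    have hbc := h01 j
    have hac : pos0 i ≠ pos1 j := by simp only [pos0, pos1, ne_eq, Fin.mk.injEq]; omega
    rw [hmid] at hbc ⊢
    exact ⟨superFlip_braid p ε hab hbc hac,
      capCup_mul_capCup_mul_capCup hinv1 hinv2 hab hbc hac,
      capCup_mul_capCup_mul_capCup' hinv1 hinv2 hab hbc hac,
      superFlip_mul_capCup_mul_capCup p ε hhi0 hinv1 hab hbc hac,
      capCup_mul_capCup_mul_superFlip p ε hlo0 hinv1 hab hbc hac⟩
end

section
/- With a supermetric as in the context, define for u ∈ ℂ the complex matrix R̂(u) := u(u+β)·P − ε(u+β)·Id + εu·K on I × I. Let R̂₁₂(u) := R̂(u) ⊗ Id and R̂₂₃(u) := Id ⊗ R̂(u) acting on I × I × I (Kronecker products with the identity matrix on the remaining factor). Then the braid form of the Yang–Baxter equation holds for all u, v ∈ ℂ: R̂₁₂(u−v)·R̂₂₃(u)·R̂₁₂(v) = R̂₂₃(v)·R̂₁₂(u)·R̂₂₃(u−v). -/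
/-- The Baxterized element `u(u+β)s - (u+β) + ue` satisfies the braid Yang–Baxter equation
whenever `s₁, s₂, e₁, e₂` satisfy the relations of the Brauer algebra with parameter `2 - 2β`. -/
theorem brauer_braid_yang_baxter {A : Type*} [Ring A] [Algebra ℂ A] (β : ℂ) (s₁ s₂ e₁ e₂ : A)
    (s₁_sq : s₁ * s₁ = 1) (s₂_sq : s₂ * s₂ = 1) (braid : s₂ * (s₁ * s₂) = s₁ * (s₂ * s₁))
    (e₁_sq : e₁ * e₁ = (2 - 2 * β) • e₁) (e₂_sq : e₂ * e₂ = (2 - 2 * β) • e₂)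
    (se₁ : s₁ * e₁ = e₁) (es₁ : e₁ * s₁ = e₁) (se₂ : s₂ * e₂ = e₂) (es₂ : e₂ * s₂ = e₂)
    (eee₁ : e₁ * (e₂ * e₁) = e₁) (eee₂ : e₂ * (e₁ * e₂) = e₂)
    (see₁ : s₁ * (e₂ * e₁) = s₂ * e₁) (see₂ : s₂ * (e₁ * e₂) = s₁ * e₂)
    (ees₁ : e₁ * (e₂ * s₁) = e₁ * s₂) (ees₂ : e₂ * (e₁ * s₂) = e₂ * s₁)
    (R₁ R₂ : ℂ → A)
    (hR₁ : ∀ u, R₁ u = (u * (u + β)) • s₁ - (u + β) • (1 : A) + u • e₁)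
    (hR₂ : ∀ u, R₂ u = (u * (u + β)) • s₂ - (u + β) • (1 : A) + u • e₂) (u v : ℂ) :
    R₁ (u - v) * R₂ u * R₁ v = R₂ v * R₁ u * R₂ (u - v) := by
  have sse₁ : s₁ * (s₂ * e₁) = e₂ * e₁ := by rw [← see₁, ← mul_assoc, s₁_sq, one_mul]
  have sse₂ : s₂ * (s₁ * e₂) = e₁ * e₂ := by rw [← see₂, ← mul_assoc, s₂_sq, one_mul]
  have ess₁ : e₁ * (s₂ * s₁) = e₁ * e₂ := by
    rw [← mul_assoc, ← ees₁, mul_assoc, mul_assoc, s₁_sq, mul_one]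
  have ess₂ : e₂ * (s₁ * s₂) = e₂ * e₁ := by
    rw [← mul_assoc, ← ees₂, mul_assoc, mul_assoc, s₂_sq, mul_one]
  have ese₁ : e₁ * (s₂ * e₁) = e₁ := by rw [← see₁, ← mul_assoc, es₁, eee₁]
  have ese₂ : e₂ * (s₁ * e₂) = e₂ := by rw [← see₂, ← mul_assoc, es₂, eee₂]
  have ses : s₂ * (e₁ * s₂) = s₁ * (e₂ * s₁) := by
    rw [← mul_assoc s₁, ← see₂, mul_assoc, mul_assoc, ees₁]
  simp only [hR₁, hR₂, add_mul, sub_mul, mul_add, mul_sub, smul_mul_assoc, mul_smul_comm, one_mul,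
    mul_one, mul_assoc, s₁_sq, s₂_sq, braid, e₁_sq, e₂_sq, se₁, es₁, se₂, es₂, eee₁, eee₂,
    see₁, see₂, ees₁, ees₂, sse₁, sse₂, ess₁, ess₂, ese₁, ese₂, ses]
  module

/-- Sliding a leg of the even form `f` through a superpermutation. -/
theorem sg_mul_mul_comm_of_even {ι : Type*} {p : ι → ZMod 2} {f : Matrix ι ι ℂ}
    (hf : ∀ a b, p a + p b ≠ 0 → f a b = 0) (a b c : ι) :
    sg (p a * p b) * f a c = sg (p b * p c) * f a c := by
  by_cases h : p a + p c = 0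
  · rw [show p a = p c by grind, mul_comm (p c)]
  · simp only [hf a c h, mul_zero]

/-- The rank-one operator built from a pair of bilinear forms. -/
def contraction {ι : Type*} (hi lo : Matrix ι ι ℂ) : Matrix (ι × ι) (ι × ι) ℂ :=
  Matrix.of fun a b => hi a.1 a.2 * lo b.1 b.2

theorem contraction_mul_self {ι : Type*} [Fintype ι] (hi lo : Matrix ι ι ℂ) :
    contraction hi lo * contraction hi lo =
      (∑ a, ∑ b, hi a b * lo a b) • contraction hi lo := by
  ext ⟨a, b⟩ ⟨c, d⟩
  simp only [contraction, Matrix.mul_apply, Matrix.of_apply, Fintype.sum_prod_type,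
    Matrix.smul_apply, smul_eq_mul, Finset.sum_mul]
  exact Finset.sum_congr rfl fun x _ => Finset.sum_congr rfl fun y _ => by ring

section ThreeSites

variable {ι : Type*} [Fintype ι] [DecidableEq ι]

/-- The operator `M ⊗ 1` on three sites. -/
def onFirstPair : Matrix (ι × ι) (ι × ι) ℂ →ₐ[ℂ] Matrix (ι × ι × ι) (ι × ι × ι) ℂ :=
  AlgHom.ofLinearMap
    { toFun := fun M => Matrix.of fun a b =>
        M (a.1, a.2.1) (b.1, b.2.1) * (if a.2.2 = b.2.2 then 1 else 0)
      map_add' := fun M N => by ext a b; simp only [Matrix.of_apply, Matrix.add_apply, add_mul]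
      map_smul' := fun c M => by ext a b; simp }
    (by
      ext ⟨a, b, c⟩ ⟨d, e, f⟩
      simp only [LinearMap.coe_mk, AddHom.coe_mk, Matrix.of_apply, Matrix.one_apply,
        Prod.mk.injEq]
      grind)
    (fun M N => by
      ext ⟨a, b, c⟩ ⟨d, e, f⟩
      simp [Matrix.mul_apply, Fintype.sum_prod_type])

/-- The operator `1 ⊗ M` on three sites. -/
def onLastPair : Matrix (ι × ι) (ι × ι) ℂ →ₐ[ℂ] Matrix (ι × ι × ι) (ι × ι × ι) ℂ :=
  AlgHom.ofLinearMap
    { toFun := fun M => Matrix.of fun a b =>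
        (if a.1 = b.1 then 1 else 0) * M (a.2.1, a.2.2) (b.2.1, b.2.2)
      map_add' := fun M N => by ext a b; simp only [Matrix.of_apply, Matrix.add_apply, mul_add]
      map_smul' := fun c M => by ext a b; simp }
    (by
      ext ⟨a, b, c⟩ ⟨d, e, f⟩
      simp only [LinearMap.coe_mk, AddHom.coe_mk, Matrix.of_apply, Matrix.one_apply,
        Prod.mk.injEq]
      grind)
    (fun M N => by
      ext ⟨a, b, c⟩ ⟨d, e, f⟩
      simp [Matrix.mul_apply, Fintype.sum_prod_type])

theorem onFirstPair_apply (M : Matrix (ι × ι) (ι × ι) ℂ) (a b : ι × ι × ι) :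
    onFirstPair M a b =
      M (a.1, a.2.1) (b.1, b.2.1) * (if a.2.2 = b.2.2 then 1 else 0) :=
  rfl

theorem onLastPair_apply (M : Matrix (ι × ι) (ι × ι) ℂ) (a b : ι × ι × ι) :
    onLastPair M a b =
      (if a.1 = b.1 then 1 else 0) * M (a.2.1, a.2.2) (b.2.1, b.2.2) :=
  rfl

/-- The superpermutation. -/
noncomputable def superPerm (p : ι → ZMod 2) : Matrix (ι × ι) (ι × ι) ℂ :=
  Matrix.of fun a b => sg (p a.1 * p a.2) * (if a.1 = b.2 then 1 else 0) *
    (if a.2 = b.1 then 1 else 0)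

theorem superPerm_mul_apply (p : ι → ZMod 2) (M : Matrix (ι × ι) (ι × ι) ℂ) (a b : ι)
    (x : ι × ι) : (superPerm p * M) (a, b) x = sg (p a * p b) * M (b, a) x := by
  simp [superPerm, Matrix.mul_apply, Fintype.sum_prod_type]

theorem mul_superPerm_apply (p : ι → ZMod 2) (M : Matrix (ι × ι) (ι × ι) ℂ) (x : ι × ι)
    (a b : ι) : (M * superPerm p) x (a, b) = sg (p a * p b) * M x (b, a) := by
  simp [superPerm, Matrix.mul_apply, Fintype.sum_prod_type, mul_comm]

theorem onFirstPair_superPerm_mul_apply (p : ι → ZMod 2)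
    (M : Matrix (ι × ι × ι) (ι × ι × ι) ℂ) (a b c : ι) (x : ι × ι × ι) :
    (onFirstPair (superPerm p) * M) (a, b, c) x = sg (p a * p b) * M (b, a, c) x := by
  simp [onFirstPair_apply, superPerm, Matrix.mul_apply, Fintype.sum_prod_type]

theorem mul_onFirstPair_superPerm_apply (p : ι → ZMod 2)
    (M : Matrix (ι × ι × ι) (ι × ι × ι) ℂ) (x : ι × ι × ι) (a b c : ι) :
    (M * onFirstPair (superPerm p)) x (a, b, c) = sg (p a * p b) * M x (b, a, c) := by
  simp [onFirstPair_apply, superPerm, Matrix.mul_apply, Fintype.sum_prod_type, mul_comm]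

theorem onLastPair_superPerm_mul_apply (p : ι → ZMod 2)
    (M : Matrix (ι × ι × ι) (ι × ι × ι) ℂ) (a b c : ι) (x : ι × ι × ι) :
    (onLastPair (superPerm p) * M) (a, b, c) x = sg (p b * p c) * M (a, c, b) x := by
  simp [onLastPair_apply, superPerm, Matrix.mul_apply, Fintype.sum_prod_type]

theorem mul_onLastPair_superPerm_apply (p : ι → ZMod 2)
    (M : Matrix (ι × ι × ι) (ι × ι × ι) ℂ) (x : ι × ι × ι) (a b c : ι) :
    (M * onLastPair (superPerm p)) x (a, b, c) = sg (p b * p c) * M x (a, c, b) := by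
  simp [onLastPair_apply, superPerm, Matrix.mul_apply, Fintype.sum_prod_type, mul_comm]

theorem superPerm_mul_self (p : ι → ZMod 2) : superPerm p * superPerm p = 1 := by
  ext ⟨a, b⟩ ⟨c, d⟩
  rw [superPerm_mul_apply, superPerm, Matrix.of_apply, mul_comm (p b) (p a), ← mul_assoc,
    ← mul_assoc, sg_mul_self, Matrix.one_apply]
  grind

theorem superPerm_braid (p : ι → ZMod 2) :
    onLastPair (superPerm p) * (onFirstPair (superPerm p) * onLastPair (superPerm p)) =
      onFirstPair (superPerm p) * (onLastPair (superPerm p) * onFirstPair (superPerm p)) := by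
  ext ⟨a, b, c⟩ ⟨d, e, f⟩
  simp only [onFirstPair_superPerm_mul_apply, onLastPair_superPerm_mul_apply]
  simp only [onFirstPair_apply, onLastPair_apply, superPerm, Matrix.of_apply]
  grind

theorem superPerm_mul_contraction (p : ι → ZMod 2) {ε : ℂ} {hi : Matrix ι ι ℂ}
    (hsym : ∀ a b, hi a b = ε * sg (p a * p b) * hi b a) (hε : ε * ε = 1) (lo : Matrix ι ι ℂ) :
    superPerm p * contraction hi lo = ε • contraction hi lo := by
  ext ⟨a, b⟩ ⟨c, d⟩
  rw [superPerm_mul_apply]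
  simp only [contraction, Matrix.of_apply, Matrix.smul_apply, smul_eq_mul]
  rw [hsym a b]
  linear_combination (-(sg (p a * p b) * hi b a * lo c d)) * hε

theorem contraction_mul_superPerm (p : ι → ZMod 2) {ε : ℂ} {lo : Matrix ι ι ℂ}
    (hsym : ∀ a b, lo a b = ε * sg (p a * p b) * lo b a) (hε : ε * ε = 1) (hi : Matrix ι ι ℂ) :
    contraction hi lo * superPerm p = ε • contraction hi lo := by
  ext ⟨a, b⟩ ⟨c, d⟩
  rw [mul_superPerm_apply]
  simp only [contraction, Matrix.of_apply, Matrix.smul_apply, smul_eq_mul]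
  rw [hsym c d]
  linear_combination (-(sg (p c * p d) * lo d c * hi a b)) * hε

theorem onFirstPair_mul_onLastPair_contraction_apply {hi lo : Matrix ι ι ℂ} (h : lo * hi = 1)
    (a b c d e f : ι) :
    (onFirstPair (contraction hi lo) * onLastPair (contraction hi lo)) (a, b, c) (d, e, f) =
      hi a b * lo e f * (if d = c then 1 else 0) := by
  rw [← Matrix.one_apply, ← h]
  simp only [onFirstPair_apply, onLastPair_apply, contraction, Matrix.mul_apply, Matrix.of_apply,
    Fintype.sum_prod_type, mul_ite, ite_mul, mul_one, mul_zero, one_mul, zero_mul,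
    Finset.sum_ite_eq, Finset.sum_ite_eq', Finset.mem_univ, if_true, Finset.mul_sum,
    Finset.sum_ite_irrel, Finset.sum_const_zero]
  exact Finset.sum_congr rfl fun x _ => by ring

theorem onLastPair_mul_onFirstPair_contraction_apply {hi lo : Matrix ι ι ℂ} (h : hi * lo = 1)
    (a b c d e f : ι) :
    (onLastPair (contraction hi lo) * onFirstPair (contraction hi lo)) (a, b, c) (d, e, f) =
      hi b c * lo d e * (if a = f then 1 else 0) := by
  rw [← Matrix.one_apply, ← h]
  simp only [onFirstPair_apply, onLastPair_apply, contraction, Matrix.mul_apply, Matrix.of_apply,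
    Fintype.sum_prod_type, mul_ite, ite_mul, mul_one, mul_zero, one_mul, zero_mul,
    Finset.sum_ite_eq, Finset.sum_ite_eq', Finset.mem_univ, if_true, Finset.mul_sum,
    Finset.sum_ite_irrel, Finset.sum_const_zero]
  exact Finset.sum_congr rfl fun x _ => by ring

theorem onFirstPair_contraction_zigzag {hi lo : Matrix ι ι ℂ} (h : hi * lo = 1) :
    onFirstPair (contraction hi lo) *
        (onLastPair (contraction hi lo) * onFirstPair (contraction hi lo)) =
      onFirstPair (contraction hi lo) := by
  have h' : lo * hi = 1 := mul_eq_one_comm.mp h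
  ext ⟨a, b, c⟩ ⟨d, e, f⟩
  rw [← mul_assoc, Matrix.mul_apply]
  simp only [Fintype.sum_prod_type, onFirstPair_mul_onLastPair_contraction_apply h']
  simp only [onFirstPair_apply, contraction, Matrix.of_apply]
  rw [← Matrix.one_apply, ← h]
  simp [Matrix.mul_apply, Finset.mul_sum]
  exact Finset.sum_congr rfl fun x _ => by ring

theorem onLastPair_contraction_zigzag {hi lo : Matrix ι ι ℂ} (h : hi * lo = 1) :
    onLastPair (contraction hi lo) *
        (onFirstPair (contraction hi lo) * onLastPair (contraction hi lo)) =
      onLastPair (contraction hi lo) := by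
  have h' : lo * hi = 1 := mul_eq_one_comm.mp h
  ext ⟨a, b, c⟩ ⟨d, e, f⟩
  rw [← mul_assoc, Matrix.mul_apply]
  simp only [Fintype.sum_prod_type, onLastPair_mul_onFirstPair_contraction_apply h]
  simp only [onLastPair_apply, contraction, Matrix.of_apply]
  have hda : (if a = d then 1 else 0) = (lo * hi) d a := by
    rw [h', Matrix.one_apply]; simp only [eq_comm]
  rw [hda]
  simp [Matrix.mul_apply, Finset.sum_mul]
  exact Finset.sum_congr rfl fun x _ => by ring

theorem superPerm_mul_contraction_mul_contraction {p : ι → ZMod 2} {hi lo : Matrix ι ι ℂ}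
    (hhi : ∀ a b, p a + p b ≠ 0 → hi a b = 0) (h : hi * lo = 1) :
    onFirstPair (superPerm p) *
        (onLastPair (contraction hi lo) * onFirstPair (contraction hi lo)) =
      onLastPair (superPerm p) * onFirstPair (contraction hi lo) := by
  ext ⟨a, b, c⟩ ⟨d, e, f⟩
  rw [onFirstPair_superPerm_mul_apply, onLastPair_superPerm_mul_apply,
    onLastPair_mul_onFirstPair_contraction_apply h, onFirstPair_apply]
  simp only [contraction, Matrix.of_apply]
  linear_combination (lo d e * if b = f then 1 else 0) * sg_mul_mul_comm_of_even hhi a b c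

theorem superPerm_mul_contraction_mul_contraction' {p : ι → ZMod 2} {hi lo : Matrix ι ι ℂ}
    (hhi : ∀ a b, p a + p b ≠ 0 → hi a b = 0) (h : lo * hi = 1) :
    onLastPair (superPerm p) *
        (onFirstPair (contraction hi lo) * onLastPair (contraction hi lo)) =
      onFirstPair (superPerm p) * onLastPair (contraction hi lo) := by
  ext ⟨a, b, c⟩ ⟨d, e, f⟩
  rw [onFirstPair_superPerm_mul_apply, onLastPair_superPerm_mul_apply,
    onFirstPair_mul_onLastPair_contraction_apply h, onLastPair_apply]
  simp only [contraction, Matrix.of_apply, eq_comm (a := d)]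
  linear_combination (-(lo e f * if b = d then 1 else 0)) * sg_mul_mul_comm_of_even hhi a b c

theorem contraction_mul_contraction_mul_superPerm {p : ι → ZMod 2} {hi lo : Matrix ι ι ℂ}
    (hlo : ∀ a b, p a + p b ≠ 0 → lo a b = 0) (h : lo * hi = 1) :
    onFirstPair (contraction hi lo) *
        (onLastPair (contraction hi lo) * onFirstPair (superPerm p)) =
      onFirstPair (contraction hi lo) * onLastPair (superPerm p) := by
  ext ⟨a, b, c⟩ ⟨d, e, f⟩
  rw [← mul_assoc, mul_onFirstPair_superPerm_apply, mul_onLastPair_superPerm_apply,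
    onFirstPair_mul_onLastPair_contraction_apply h, onFirstPair_apply]
  simp only [contraction, Matrix.of_apply, eq_comm (a := e)]
  linear_combination (hi a b * if c = e then 1 else 0) * sg_mul_mul_comm_of_even hlo d e f

theorem contraction_mul_contraction_mul_superPerm' {p : ι → ZMod 2} {hi lo : Matrix ι ι ℂ}
    (hlo : ∀ a b, p a + p b ≠ 0 → lo a b = 0) (h : hi * lo = 1) :
    onLastPair (contraction hi lo) *
        (onFirstPair (contraction hi lo) * onLastPair (superPerm p)) =
      onLastPair (contraction hi lo) * onFirstPair (superPerm p) := by
  ext ⟨a, b, c⟩ ⟨d, e, f⟩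
  rw [← mul_assoc, mul_onFirstPair_superPerm_apply, mul_onLastPair_superPerm_apply,
    onLastPair_mul_onFirstPair_contraction_apply h, onLastPair_apply]
  simp only [contraction, Matrix.of_apply]
  linear_combination (-(hi b c * if a = e then 1 else 0)) * sg_mul_mul_comm_of_even hlo d e f

end ThreeSites

/-- The braid form of the Yang–Baxter equation for the fundamental osp R-matrix
R̂(u) = u(u+β)·P − ε(u+β)·Id + εu·K. -/
theorem braid_yang_baxter
    (n : ℕ) (p : Fin n → ZMod 2) (ε : ℂ) (hε : ε = 1 ∨ ε = -1)
    (εlo εhi : Matrix (Fin n) (Fin n) ℂ)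
    (hlo0 : ∀ a b, p a + p b ≠ 0 → εlo a b = 0)
    (hhi0 : ∀ a b, p a + p b ≠ 0 → εhi a b = 0)
    (hlosym : ∀ a b, εlo a b = ε * sg (p a * p b) * εlo b a)
    (hhisym : ∀ a b, εhi a b = ε * sg (p a * p b) * εhi b a)
    (hinv1 : ∀ a c, (∑ b, εhi a b * εlo b c) = if a = c then 1 else 0)
    (hinv2 : ∀ a c, (∑ b, εlo a b * εhi b c) = if a = c then 1 else 0) :
    let ω : ℂ := ∑ a, ∑ b, εhi a b * εlo a b
    let β : ℂ := 1 - ω / 2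
    let P : Matrix (Fin n × Fin n) (Fin n × Fin n) ℂ :=
      Matrix.of fun a b => sg (p a.1 * p a.2) * (if a.1 = b.2 then 1 else 0) *
        (if a.2 = b.1 then 1 else 0)
    let K : Matrix (Fin n × Fin n) (Fin n × Fin n) ℂ :=
      Matrix.of fun a b => εhi a.1 a.2 * εlo b.1 b.2
    let Rh : ℂ → Matrix (Fin n × Fin n) (Fin n × Fin n) ℂ := fun u =>
      (u * (u + β)) • P - (ε * (u + β)) • (1 : Matrix (Fin n × Fin n) (Fin n × Fin n) ℂ) +
        (ε * u) • K
    let Rh12 : ℂ → Matrix (Fin n × Fin n × Fin n) (Fin n × Fin n × Fin n) ℂ := fun u =>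
      Matrix.of fun a b => Rh u (a.1, a.2.1) (b.1, b.2.1) * (if a.2.2 = b.2.2 then 1 else 0)
    let Rh23 : ℂ → Matrix (Fin n × Fin n × Fin n) (Fin n × Fin n × Fin n) ℂ := fun u =>
      Matrix.of fun a b => (if a.1 = b.1 then 1 else 0) * Rh u (a.2.1, a.2.2) (b.2.1, b.2.2)
    ∀ u v : ℂ, Rh12 (u - v) * Rh23 u * Rh12 v = Rh23 v * Rh12 u * Rh23 (u - v) := by
  intro ω β P K Rh Rh12 Rh23 u v
  have hε2 : ε * ε = 1 := by rcases hε with rfl | rfl <;> norm_num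
  have h : εhi * εlo = 1 := by ext a c; rw [Matrix.mul_apply, hinv1, Matrix.one_apply]
  have h' : εlo * εhi = 1 := by ext a c; rw [Matrix.mul_apply, hinv2, Matrix.one_apply]
  have hKK : K * K = (2 - 2 * β) • K := by
    rw [show 2 - 2 * β = ω by ring]; exact contraction_mul_self εhi εlo
  have hPP : (ε • P) * (ε • P) = 1 := by
    rw [smul_mul_smul_comm, hε2, one_smul]; exact superPerm_mul_self p
  have hPK : (ε • P) * K = K := by
    rw [smul_mul_assoc, show P * K = ε • K from superPerm_mul_contraction p hhisym hε2 εlo,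
      smul_smul, hε2, one_smul]
  have hKP : K * (ε • P) = K := by
    rw [mul_smul_comm, show K * P = ε • K from contraction_mul_superPerm p hlosym hε2 εhi,
      smul_smul, hε2, one_smul]
  have hRh (w : ℂ) : ε • Rh w = (w * (w + β)) • (ε • P) - (w + β) • 1 + w • K := by
    simp only [Rh, smul_add, smul_sub, smul_smul]
    rw [mul_comm ε (w * (w + β)), ← mul_assoc, ← mul_assoc, hε2, one_mul, one_mul]
  have key := brauer_braid_yang_baxter β (onFirstPair (ε • P)) (onLastPair (ε • P))
    (onFirstPair K) (onLastPair K)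
    (by rw [← map_mul, hPP, map_one]) (by rw [← map_mul, hPP, map_one])
    (by
      simp only [map_smul, smul_mul_assoc, mul_smul_comm]
      exact congrArg (fun M => ε • ε • ε • M) (superPerm_braid p))
    (by rw [← map_mul, hKK, map_smul]) (by rw [← map_mul, hKK, map_smul])
    (by rw [← map_mul, hPK]) (by rw [← map_mul, hKP])
    (by rw [← map_mul, hPK]) (by rw [← map_mul, hKP])
    (onFirstPair_contraction_zigzag h) (onLastPair_contraction_zigzag h)
    (by
      simp only [map_smul, smul_mul_assoc]
      exact congrArg (ε • ·) (superPerm_mul_contraction_mul_contraction hhi0 h))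
    (by
      simp only [map_smul, smul_mul_assoc]
      exact congrArg (ε • ·) (superPerm_mul_contraction_mul_contraction' hhi0 h'))
    (by
      simp only [map_smul, mul_smul_comm]
      exact congrArg (ε • ·) (contraction_mul_contraction_mul_superPerm hlo0 h'))
    (by
      simp only [map_smul, mul_smul_comm]
      exact congrArg (ε • ·) (contraction_mul_contraction_mul_superPerm' hlo0 h))
    (fun w => onFirstPair (ε • Rh w)) (fun w => onLastPair (ε • Rh w))
    (fun w => by simp only [hRh, map_add, map_sub, map_smul, map_one])
    (fun w => by simp only [hRh, map_add, map_sub, map_smul, map_one]) u v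
  have hε0 : ε ≠ 0 := left_ne_zero_of_mul_eq_one hε2
  simp only [map_smul, smul_mul_assoc, mul_smul_comm] at key
  exact smul_right_injective _ hε0 (smul_right_injective _ hε0 (smul_right_injective _ hε0 key))
end

section
/- With a supermetric as in the context, for any complex matrix A indexed by I define the supertrace str(A) := Σ_a (−1)^{[a]} A^a_a, and on I × I set A₁ := A ⊗ Id and A₂ := Id ⊗ A. Then: (i) K·K = ω·K; (ii) K·A₁·K = ε·str(A)·K; and (iii) K·(Σ12·A₂·Σ12)·K = ε·str(A)·K. -/
open Matrix in
/-- A rank-one matrix `u vᵀ` absorbs any matrix sandwiched between two copies of it,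
up to the scalar `vᵀ M u`. -/
theorem vecMulVec_mul_mul_vecMulVec {ι R : Type*} [Fintype ι] [CommSemiring R]
    (u v : ι → R) (M : Matrix ι ι R) :
    vecMulVec u v * M * vecMulVec u v = (v ⬝ᵥ M *ᵥ u) • vecMulVec u v := by
  rw [Matrix.vecMulVec_mul, Matrix.vecMulVec_mul_vecMulVec, ← Matrix.dotProduct_mulVec,
    Matrix.vecMulVec_smul]

/-- On the support of an even tensor the exchange sign depends on one index only. -/
theorem sg_mul_eq_of_even {x y : ZMod 2} {c : ℂ} (h : x + y ≠ 0 → c = 0) :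
    sg (x * y) * c = sg y * c := by
  by_cases hxy : x + y = 0
  · have hy : x * y = y := by
      clear h
      decide +revert
    rw [hy]
  · rw [h hxy, mul_zero, mul_zero]

/-- Identities for the invariant tensor K: K·K = ω·K, K·A₁·K = ε·str(A)·K and
K·(Σ12·A₂·Σ12)·K = ε·str(A)·K, where str is the supertrace. -/
theorem K_contraction_identities
    (n : ℕ) (p : Fin n → ZMod 2) (ε : ℂ) (hε : ε = 1 ∨ ε = -1)
    (εlo εhi : Matrix (Fin n) (Fin n) ℂ)
    (hlo0 : ∀ a b, p a + p b ≠ 0 → εlo a b = 0)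
    (hhi0 : ∀ a b, p a + p b ≠ 0 → εhi a b = 0)
    (hlosym : ∀ a b, εlo a b = ε * sg (p a * p b) * εlo b a)
    (hhisym : ∀ a b, εhi a b = ε * sg (p a * p b) * εhi b a)
    (hinv1 : ∀ a c, (∑ b, εhi a b * εlo b c) = if a = c then 1 else 0)
    (hinv2 : ∀ a c, (∑ b, εlo a b * εhi b c) = if a = c then 1 else 0) :
    let ω : ℂ := ∑ a, ∑ b, εhi a b * εlo a b
    let K : Matrix (Fin n × Fin n) (Fin n × Fin n) ℂ :=
      Matrix.of fun a b => εhi a.1 a.2 * εlo b.1 b.2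
    let Sg12 : Matrix (Fin n × Fin n) (Fin n × Fin n) ℂ :=
      Matrix.of fun a b => sg (p a.1 * p a.2) * (if a = b then 1 else 0)
    ∀ A : Matrix (Fin n) (Fin n) ℂ,
      let str : ℂ := ∑ a, sg (p a) * A a a
      let A1 : Matrix (Fin n × Fin n) (Fin n × Fin n) ℂ :=
        Matrix.of fun a b => A a.1 b.1 * (if a.2 = b.2 then 1 else 0)
      let A2 : Matrix (Fin n × Fin n) (Fin n × Fin n) ℂ :=
        Matrix.of fun a b => (if a.1 = b.1 then 1 else 0) * A a.2 b.2
      K * K = ω • K ∧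
      K * A1 * K = (ε * str) • K ∧
      K * (Sg12 * A2 * Sg12) * K = (ε * str) • K := by
  intro ω K Sg12 A str A1 A2
  have hK : K = Matrix.vecMulVec (fun a => εhi a.1 a.2) (fun b => εlo b.1 b.2) := rfl
  have hhi : ∀ a b, εhi a b = ε * sg (p a) * εhi b a := fun a b => by
    have h := sg_mul_eq_of_even (hhi0 b a)
    rw [hhisym a b, mul_assoc, mul_comm (p a), h, mul_assoc]
  refine ⟨?_, ?_, ?_⟩
  · have h : K * K = K * 1 * K := by rw [mul_one]
    rw [h, hK, vecMulVec_mul_mul_vecMulVec]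
    congr 1
    simp only [Matrix.one_mulVec, dotProduct, Fintype.sum_prod_type, ω]
    simp only [mul_comm]
  · rw [hK, vecMulVec_mul_mul_vecMulVec]
    congr 1
    simp only [dotProduct, Matrix.mulVec, Fintype.sum_prod_type, A1, Matrix.of_apply, mul_ite,
      mul_one, mul_zero, ite_mul, zero_mul, Finset.sum_ite_eq, Finset.mem_univ, if_true, str]
    rw [Finset.mul_sum]
    refine Finset.sum_congr rfl fun a _ => ?_
    calc ∑ b, εlo a b * ∑ c, A a c * εhi c b
        = ∑ c, A a c * (ε * sg (p c)) * ∑ b, εlo a b * εhi b c := by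
          simp only [Finset.mul_sum]
          rw [Finset.sum_comm]
          refine Finset.sum_congr rfl fun c _ => Finset.sum_congr rfl fun b _ => ?_
          rw [hhi c b]
          ring
      _ = ε * (sg (p a) * A a a) := by
          simp only [hinv2, mul_ite, mul_one, mul_zero, Finset.sum_ite_eq, Finset.mem_univ, if_true]
          ring
  · have hM : Sg12 * A2 * Sg12 = Matrix.of fun a b =>
        if a.1 = b.1 then sg (p a.1 * p a.2) * A a.2 b.2 * sg (p b.1 * p b.2) else 0 := by
      have hS : Sg12 = Matrix.diagonal fun a => sg (p a.1 * p a.2) := by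
        ext a b
        simp [Sg12, Matrix.diagonal_apply]
      ext a b
      rw [hS, Matrix.mul_diagonal, Matrix.diagonal_mul]
      simp [A2]
    rw [hM, hK, vecMulVec_mul_mul_vecMulVec]
    congr 1
    simp only [dotProduct, Matrix.mulVec, Fintype.sum_prod_type_right, Matrix.of_apply,
      ite_mul, zero_mul, Finset.sum_ite_eq, Finset.mem_univ, if_true, str]
    rw [Finset.mul_sum]
    refine Finset.sum_congr rfl fun a _ => ?_
    calc ∑ b, εlo b a * ∑ c, sg (p b * p a) * A a c * sg (p b * p c) * εhi b c
        = ∑ c, ε * A a c * sg (p c) * ∑ b, εlo a b * εhi b c := by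
          simp only [Finset.mul_sum]
          rw [Finset.sum_comm]
          refine Finset.sum_congr rfl fun c _ => Finset.sum_congr rfl fun b _ => ?_
          have h := sg_mul_eq_of_even (hhi0 b c)
          have hs := sg_mul_self (p b * p a)
          rw [hlosym b a]
          linear_combination (ε * sg (p b * p a) * sg (p b * p a) * εlo a b * A a c) * h +
            (ε * εlo a b * A a c * sg (p c) * εhi b c) * hs
      _ = ε * (sg (p a) * A a a) := by
          simp only [hinv2, mul_ite, mul_one, mul_zero, Finset.sum_ite_eq, Finset.mem_univ, if_true]
          ring
end

section
/- With a supermetric as in the context, define the complex matrices G̃^f_g (one matrix for each pair f, g ∈ I) with entries (G̃^f_g)^a_c := ε̄^{fa} ε_{gc} − ε(−1)^{[c][a]} δ^f_c δ^a_g. Set G̃^{a2 a1} := Σ_b ε̄^{a1 b} G̃^{a2}_b and G̃_{b1 b2} := Σ_a ε_{b1 a} G̃^a_{b2} (linear combinations of these matrices), and define the supercommutator [G̃^{a1}_{b1}, G̃^{a2}_{b2}]_± := G̃^{a1}_{b1}·G̃^{a2}_{b2} − (−1)^{([a1]+[b1])([a2]+[b2])} G̃^{a2}_{b2}·G̃^{a1}_{b1}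 (matrix products). Then for all a1, b1, a2, b2 ∈ I: [G̃^{a1}_{b1}, G̃^{a2}_{b2}]_± = −(−1)^{[a1][a2]+[b1][a2]} ε̄^{a1a2} G̃_{b1b2} + ε(−1)^{[b1][a2]} δ^{a2}_{b1} G̃^{a1}_{b2} + (−1)^{[a1][a2]+[b1][a2]} ε_{b1b2} G̃^{a2a1} − ε(−1)^{[a1]([b1]+[a2])+[b1][a2]} δ^{a1}_{b2} G̃^{a2}_{b1}. (These are the defining supercommutation relations of the ortho-symplectic Lie superalgebra osp in its fundamental representation.) -/
theorem sg_add (x y : ZMod 2) : sg (x + y) = sg x * sg y := by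
  have zero_or_one : ∀ z : ZMod 2, z = 0 ∨ z = 1 := by decide
  rcases zero_or_one x with rfl | rfl <;> rcases zero_or_one y with rfl | rfl <;>
    simp [sg, show (1 + 1 : ZMod 2) = 0 from rfl]

theorem eq_of_parity_add_eq_zero {x y : ZMod 2} (h : x + y = 0) : x = y := by
  revert x y; decide

/-- The matrix (G̃^f_g)^a_c = ε̄^{fa} ε_{gc} − ε(−1)^{[c][a]} δ^f_c δ^a_g. -/
noncomputable def ospGen {ι : Type*} [DecidableEq ι] (p : ι → ZMod 2) (ε : ℂ)
    (εlo εhi : Matrix ι ι ℂ) (f g : ι) : Matrix ι ι ℂ :=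
  Matrix.of fun a c =>
    εhi f a * εlo g c - ε * sg (p c * p a) * (if f = c then 1 else 0) *
      (if a = g then 1 else 0)

section ospGen

variable {ι : Type*} [Fintype ι] [DecidableEq ι] {p : ι → ZMod 2} {ε : ℂ}
  {εlo εhi : Matrix ι ι ℂ}

/-- Contracting the second indices of a supermetric and its inverse produces the sign of the
supersymmetry. -/
theorem sum_lo_mul_hi_swap (hhi0 : ∀ a b, p a + p b ≠ 0 → εhi a b = 0)
    (hhisym : ∀ a b, εhi a b = ε * sg (p a * p b) * εhi b a)
    (hinv2 : ∀ a c, (∑ b, εlo a b * εhi b c) = if a = c then 1 else 0) (g f : ι) :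
    ∑ e, εlo g e * εhi f e = ε * sg (p f) * (if g = f then 1 else 0) := by
  rw [← hinv2, Finset.mul_sum]
  refine Finset.sum_congr rfl fun e _ => ?_
  by_cases h : p f + p e = 0
  · have hsq : ∀ x : ZMod 2, x * x = x := by decide
    rw [hhisym f e, ← eq_of_parity_add_eq_zero h, hsq]
    ring
  · rw [hhi0 f e h, hhi0 e f (by rwa [add_comm])]
    ring

theorem ospGen_mul_apply (hε : ε * ε = 1) (hhi0 : ∀ a b, p a + p b ≠ 0 → εhi a b = 0)
    (hhisym : ∀ a b, εhi a b = ε * sg (p a * p b) * εhi b a)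
    (hinv2 : ∀ a c, (∑ b, εlo a b * εhi b c) = if a = c then 1 else 0) (f g f' g' a c : ι) :
    (ospGen p ε εlo εhi f g * ospGen p ε εlo εhi f' g') a c =
      ε * sg (p f') * (if g = f' then 1 else 0) * (εhi f a * εlo g' c)
        - ε * sg (p f' * p g') * (if f' = c then 1 else 0) * (εhi f a * εlo g g')
        - ε * sg (p f * p g) * (if a = g then 1 else 0) * (εhi f' f * εlo g' c)
        + sg (p f * p g) * sg (p f' * p g') * (if a = g then 1 else 0) *
          (if f = g' then 1 else 0) * (if f' = c then 1 else 0) := by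
  have hterm : ∀ e, ospGen p ε εlo εhi f g a e * ospGen p ε εlo εhi f' g' e c =
      εhi f a * εlo g' c * (εlo g e * εhi f' e)
        - (if e = g' then
            ε * sg (p f' * p g') * (if f' = c then 1 else 0) * (εhi f a * εlo g g') else 0)
        - (if f = e then
            ε * sg (p f * p g) * (if a = g then 1 else 0) * (εhi f' f * εlo g' c) else 0)
        + (if f = e then sg (p f * p g) * sg (p f' * p g') * (if a = g then 1 else 0) *
          (if f = g' then 1 else 0) * (if f' = c then 1 else 0) else 0) := by
    intro e
    simp only [ospGen, Matrix.of_apply]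
    split_ifs <;> subst_vars <;> first
      | contradiction
      | ring1
      | linear_combination sg (p e * p a) * sg (p c * p e) * hε
  rw [Matrix.mul_apply, Finset.sum_congr rfl fun e _ => hterm e, Finset.sum_add_distrib,
    Finset.sum_sub_distrib, Finset.sum_sub_distrib, ← Finset.mul_sum,
    sum_lo_mul_hi_swap hhi0 hhisym hinv2]
  simp only [Finset.sum_ite_eq, Finset.sum_ite_eq', Finset.mem_univ, if_true]
  ring

theorem sum_lo_smul_ospGen_apply
    (hinv2 : ∀ a c, (∑ b, εlo a b * εhi b c) = if a = c then 1 else 0) (b₁ b₂ x c : ι) :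
    (∑ a, εlo b₁ a • ospGen p ε εlo εhi a b₂) x c =
      (if b₁ = x then 1 else 0) * εlo b₂ c
        - ε * sg (p c * p x) * (if x = b₂ then 1 else 0) * εlo b₁ c := by
  simp only [Matrix.sum_apply, Matrix.smul_apply, ospGen, Matrix.of_apply, smul_eq_mul, mul_sub,
    Finset.sum_sub_distrib, ← mul_assoc, ← Finset.sum_mul, hinv2]
  simp only [mul_ite, mul_one, mul_zero, Finset.sum_ite_eq', Finset.mem_univ, if_true]
  split_ifs <;> ring

theorem sum_hi_smul_ospGen_apply
    (hinv1 : ∀ a c, (∑ b, εhi a b * εlo b c) = if a = c then 1 else 0) (a₂ a₁ x c : ι) :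
    (∑ b, εhi a₁ b • ospGen p ε εlo εhi a₂ b) x c =
      (if a₁ = c then 1 else 0) * εhi a₂ x
        - ε * sg (p c * p x) * (if a₂ = c then 1 else 0) * εhi a₁ x := by
  have hterm : ∀ b, εhi a₁ b * ospGen p ε εlo εhi a₂ b x c =
      εhi a₂ x * (εhi a₁ b * εlo b c)
        - (if x = b then ε * sg (p c * p x) * (if a₂ = c then 1 else 0) * εhi a₁ x else 0) := by
    intro b
    simp only [ospGen, Matrix.of_apply]
    split_ifs <;> subst_vars <;> ring
  simp only [Matrix.sum_apply, Matrix.smul_apply, smul_eq_mul]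
  rw [Finset.sum_congr rfl fun b _ => hterm b, Finset.sum_sub_distrib, ← Finset.mul_sum, hinv1]
  simp only [Finset.sum_ite_eq, Finset.mem_univ, if_true]
  ring

end ospGen

/-- The defining supercommutation relations of the ortho-symplectic Lie superalgebra osp
in its fundamental representation, for the basis matrices
(G̃^f_g)^a_c = ε̄^{fa} ε_{gc} − ε(−1)^{[c][a]} δ^f_c δ^a_g. -/
theorem osp_fundamental_commutation_relations
    (n : ℕ) (p : Fin n → ZMod 2) (ε : ℂ) (hε : ε = 1 ∨ ε = -1)
    (εlo εhi : Matrix (Fin n) (Fin n) ℂ)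
    (hlo0 : ∀ a b, p a + p b ≠ 0 → εlo a b = 0)
    (hhi0 : ∀ a b, p a + p b ≠ 0 → εhi a b = 0)
    (hlosym : ∀ a b, εlo a b = ε * sg (p a * p b) * εlo b a)
    (hhisym : ∀ a b, εhi a b = ε * sg (p a * p b) * εhi b a)
    (hinv1 : ∀ a c, (∑ b, εhi a b * εlo b c) = if a = c then 1 else 0)
    (hinv2 : ∀ a c, (∑ b, εlo a b * εhi b c) = if a = c then 1 else 0) :
    let Gt : Fin n → Fin n → Matrix (Fin n) (Fin n) ℂ := fun f g =>
      Matrix.of fun a c =>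
        εhi f a * εlo g c - ε * sg (p c * p a) * (if f = c then 1 else 0) *
          (if a = g then 1 else 0)
    let Gupup : Fin n → Fin n → Matrix (Fin n) (Fin n) ℂ := fun a2 a1 =>
      ∑ b, εhi a1 b • Gt a2 b
    let Gdown : Fin n → Fin n → Matrix (Fin n) (Fin n) ℂ := fun b1 b2 =>
      ∑ a, εlo b1 a • Gt a b2
    ∀ a1 b1 a2 b2 : Fin n,
      Gt a1 b1 * Gt a2 b2 -
          sg ((p a1 + p b1) * (p a2 + p b2)) • (Gt a2 b2 * Gt a1 b1) =
        (-(sg (p a1 * p a2 + p b1 * p a2)) * εhi a1 a2) • Gdown b1 b2 +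
          (ε * sg (p b1 * p a2) * (if a2 = b1 then 1 else 0)) • Gt a1 b2 +
          (sg (p a1 * p a2 + p b1 * p a2) * εlo b1 b2) • Gupup a2 a1 -
          (ε * sg (p a1 * (p b1 + p a2) + p b1 * p a2) *
            (if a1 = b2 then 1 else 0)) • Gt a2 b1 := by
  intro Gt Gupup Gdown a1 b1 a2 b2
  have hε2 : ε * ε = 1 := by rcases hε with rfl | rfl <;> norm_num
  change ospGen p ε εlo εhi a1 b1 * ospGen p ε εlo εhi a2 b2 -
      sg _ • (ospGen p ε εlo εhi a2 b2 * ospGen p ε εlo εhi a1 b1) =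
    _ • (∑ a, εlo b1 a • ospGen p ε εlo εhi a b2) + _ • ospGen p ε εlo εhi a1 b2 +
      _ • (∑ b, εhi a1 b • ospGen p ε εlo εhi a2 b) - _ • ospGen p ε εlo εhi a2 b1
  ext x c
  simp only [Matrix.sub_apply, Matrix.add_apply, Matrix.smul_apply, smul_eq_mul,
    ospGen_mul_apply hε2 hhi0 hhisym hinv2, sum_lo_smul_ospGen_apply hinv2,
    sum_hi_smul_ospGen_apply hinv1]
  simp only [ospGen, Matrix.of_apply]
  have hlo : ∀ a b, p a = p b ∨ εlo a b = 0 := fun a b =>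
    (em (p a + p b = 0)).imp eq_of_parity_add_eq_zero (hlo0 a b)
  have hhi : ∀ a b, p a = p b ∨ εhi a b = 0 := fun a b =>
    (em (p a + p b = 0)).imp eq_of_parity_add_eq_zero (hhi0 a b)
  have t1 : ε * sg (p a2) * (if b1 = a2 then 1 else 0) * (εhi a1 x * εlo b2 c) =
      ε * sg (p b1 * p a2) * (if a2 = b1 then 1 else 0) * (εhi a1 x * εlo b2 c) := by
    by_cases h : a2 = b1
    · subst h
      rw [show p a2 * p a2 = p a2 by generalize p a2 = u; decide +revert]
    · simp [h, Ne.symm h]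
  have t2 : ε * sg (p a2 * p b2) * (if a2 = c then 1 else 0) * (εhi a1 x * εlo b1 b2) =
      sg (p a1 * p a2 + p b1 * p a2) * εlo b1 b2 *
        (ε * sg (p c * p x) * (if a2 = c then 1 else 0) * εhi a1 x) := by
    rcases hhi a1 x with h | h
    · rcases hlo b1 b2 with h' | h'
      · by_cases hc : a2 = c
        · subst hc
          have hs : sg (p a2 * p b2) = sg (p a1 * p a2 + p b1 * p a2) * sg (p a2 * p x) := by
            rw [← sg_add, ← h, ← h']
            generalize p a1 = u, p a2 = v, p b1 = w
            exact congrArg sg (by decide +revert)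
          rw [hs]; ring
        · simp [hc]
      · simp [h']
    · simp [h]
  have t3 : ε * sg (p a1 * p b1) * (if x = b1 then 1 else 0) * (εhi a2 a1 * εlo b2 c) =
      sg (p a1 * p a2 + p b1 * p a2) * εhi a1 a2 * ((if b1 = x then 1 else 0) * εlo b2 c) := by
    rw [hhisym a2 a1]
    rcases hhi a1 a2 with h | h
    · have hs : sg (p a1 * p b1) * sg (p a2 * p a1) = sg (p a1 * p a2 + p b1 * p a2) := by
        rw [← sg_add, ← h]
        generalize p a1 = u, p b1 = w
        exact congrArg sg (by decide +revert)
      simp only [← hs, eq_comm (a := b1) (b := x)]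
      linear_combination sg (p a1 * p b1) * (if x = b1 then 1 else 0) *
        (sg (p a2 * p a1) * εhi a1 a2 * εlo b2 c) * hε2
    · simp [h]
  have t4 : sg (p a1 * p b1) * sg (p a2 * p b2) * (if x = b1 then 1 else 0) *
        (if a1 = b2 then 1 else 0) * (if a2 = c then 1 else 0) =
      ε * sg (p a1 * (p b1 + p a2) + p b1 * p a2) * (if a1 = b2 then 1 else 0) *
        (ε * sg (p c * p x) * (if a2 = c then 1 else 0) * (if x = b1 then 1 else 0)) := by
    split_ifs with hx ha hc <;> try simp
    subst hx ha hc
    have hs : sg (p a1 * p x) * sg (p a2 * p a1) =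
        sg (p a1 * (p x + p a2) + p x * p a2) * sg (p a2 * p x) := by
      rw [← sg_add, ← sg_add]
      generalize p a1 = u, p a2 = v, p x = w
      exact congrArg sg (by decide +revert)
    linear_combination hs - sg (p a1 * (p x + p a2) + p x * p a2) * sg (p a2 * p x) * hε2
  have s1 : sg ((p a1 + p b1) * (p a2 + p b2)) *
        (ε * sg (p a1) * (if b2 = a1 then 1 else 0) * (εhi a2 x * εlo b1 c)) =
      ε * sg (p a1 * (p b1 + p a2) + p b1 * p a2) * (if a1 = b2 then 1 else 0) *
        (εhi a2 x * εlo b1 c) := by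
    by_cases h : a1 = b2
    · subst h
      have hs : sg ((p a1 + p b1) * (p a2 + p a1)) * sg (p a1) =
          sg (p a1 * (p b1 + p a2) + p b1 * p a2) := by
        rw [← sg_add]
        generalize p a1 = u, p a2 = v, p b1 = w
        exact congrArg sg (by decide +revert)
      rw [← hs]; ring
    · simp [h, Ne.symm h]
  have s2 : sg ((p a1 + p b1) * (p a2 + p b2)) *
        (ε * sg (p a1 * p b1) * (if a1 = c then 1 else 0) * (εhi a2 x * εlo b2 b1)) =
      sg (p a1 * p a2 + p b1 * p a2) * εlo b1 b2 * ((if a1 = c then 1 else 0) * εhi a2 x) := by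
    rw [hlosym b2 b1]
    rcases hlo b1 b2 with h | h
    · have hs : sg ((p a1 + p b1) * (p a2 + p b2)) * sg (p a1 * p b1) * sg (p b2 * p b1) =
          sg (p a1 * p a2 + p b1 * p a2) := by
        rw [← sg_add, ← sg_add, ← h]
        generalize p a1 = u, p a2 = v, p b1 = w
        exact congrArg sg (by decide +revert)
      rw [← hs]
      linear_combination sg ((p a1 + p b1) * (p a2 + p b2)) * sg (p a1 * p b1) *
        sg (p b2 * p b1) * εlo b1 b2 * ((if a1 = c then 1 else 0) * εhi a2 x) * hε2
    · simp [h]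
  have s3 : sg ((p a1 + p b1) * (p a2 + p b2)) *
        (ε * sg (p a2 * p b2) * (if x = b2 then 1 else 0) * (εhi a1 a2 * εlo b1 c)) =
      sg (p a1 * p a2 + p b1 * p a2) * εhi a1 a2 *
        (ε * sg (p c * p x) * (if x = b2 then 1 else 0) * εlo b1 c) := by
    rcases hhi a1 a2 with h | h
    · rcases hlo b1 c with h' | h'
      · by_cases hx : x = b2
        · subst hx
          have hs : sg ((p a1 + p b1) * (p a2 + p x)) * sg (p a2 * p x) =
              sg (p a1 * p a2 + p b1 * p a2) * sg (p c * p x) := by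
            rw [← sg_add, ← sg_add, ← h, ← h']
            generalize p a1 = u, p b1 = v, p x = w
            exact congrArg sg (by decide +revert)
          simp only [if_true]
          linear_combination ε * (εhi a1 a2 * εlo b1 c) * hs
        · simp [hx]
      · simp [h']
    · simp [h]
  have s4 : sg ((p a1 + p b1) * (p a2 + p b2)) *
        (sg (p a2 * p b2) * sg (p a1 * p b1) * (if x = b2 then 1 else 0) *
          (if a2 = b1 then 1 else 0) * (if a1 = c then 1 else 0)) =
      ε * sg (p b1 * p a2) * (if a2 = b1 then 1 else 0) *
        (ε * sg (p c * p x) * (if a1 = c then 1 else 0) * (if x = b2 then 1 else 0)) := by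
    split_ifs with hx ha hc <;> try simp
    subst hx ha hc
    have hs : sg ((p a1 + p a2) * (p a2 + p x)) * (sg (p a2 * p x) * sg (p a1 * p a2)) =
        sg (p a2 * p a2) * sg (p a1 * p x) := by
      rw [← sg_add, ← sg_add, ← sg_add]
      generalize p a1 = u, p a2 = v, p x = w
      exact congrArg sg (by decide +revert)
    linear_combination hs - sg (p a2 * p a2) * sg (p a1 * p x) * hε2
  linear_combination t1 - t2 - t3 + t4 - s1 + s2 + s3 - s4
end

section
/- With a supermetric as in the context and A a unital associative ℂ-algebra, let G be an I-indexed square matrix with entries in A, and let α ∈ ℂ. Set L(u) := (u+α)·Id + G (a matrix over A). Then L(u) satisfies the graded RLL relation R(u−v)·L₁(u)·Σ12·L₂(v)·Σ12 = Σ12·L₂(v)·Σ12·L₁(u)·R(u−v) for all u, v ∈ ℂ if and only if the following three matrix conditions over A hold: (a) G₁·(Σ12·G₂·Σ12) − (Σ12·G₂·Σ12)·G₁ = (K − εP)·G₁ − G₁·(K − εP); (b) K·(G₁ + Σ12·G₂·Σ12) = (G₁ + Σ12·G₂·Σ12)·K; (c) K·((Σ12·G₂·Σ12)·G₁ − β·G₁)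 = (G₁·(Σ12·G₂·Σ12) − β·G₁)·K. -/
section Abstract

variable {S : Type*} [Ring S] [Algebra ℂ S] {X Y P K : S}

/-- The defect of the RLL relation of a linear L-operator, factored as a polynomial in the
spectral parameters. -/
theorem linear_RLL_defect (hPX : P * X = Y * P) (hPY : P * Y = X * P) (ε β w b : ℂ) :
    ((w * (w + β)) • (1 : S) - (ε * (w + β)) • P + w • K) * ((b + w) • (1 : S) + X) *
          (b • (1 : S) + Y) -
        (b • (1 : S) + Y) * ((b + w) • (1 : S) + X) *
          ((w * (w + β)) • (1 : S) - (ε * (w + β)) • P + w • K) =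
      w • (w • (X * Y - Y * X - ε • (X * P - Y * P) + (K * Y - Y * K)) +
        b • (K * (X + Y) - (X + Y) * K) +
        (β • (X * Y - Y * X - ε • (X * P - Y * P)) + (K * X * Y - Y * X * K))) := by
  simp only [mul_add, add_mul, sub_mul, mul_sub, smul_mul_assoc, mul_smul_comm, one_mul, mul_one,
    mul_assoc, hPX, hPY]
  module

/-- A polynomial identity `w (w E + b F + C) = 0` forces all coefficients to vanish. -/
theorem forall_smul_eq_zero_iff {M : Type*} [AddCommGroup M] [Module ℂ M] {E F C : M} :
    (∀ w b : ℂ, w • (w • E + b • F + C) = 0) ↔ E = 0 ∧ F = 0 ∧ C = 0 := by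
  refine ⟨fun h => ?_, fun ⟨hE, hF, hC⟩ w b => by simp [hE, hF, hC]⟩
  have h₁ := h 1 0
  have h₂ := h (-1) 0
  have h₃ := h 1 1
  refine ⟨?_, ?_, ?_⟩
  · linear_combination (norm := module) (1 / 2 : ℂ) • h₁ + (1 / 2 : ℂ) • h₂
  · linear_combination (norm := module) h₃ - h₁
  · linear_combination (norm := module) (1 / 2 : ℂ) • h₁ - (1 / 2 : ℂ) • h₂

theorem linear_RLL_coeff_iff (hP : P * P = 1) (hPX : P * X = Y * P) (hPY : P * Y = X * P)
    (hPK : P * K * P = K) (ε β : ℂ) :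
    (X * Y - Y * X - ε • (X * P - Y * P) + (K * Y - Y * K) = 0 ∧
        K * (X + Y) - (X + Y) * K = 0 ∧
        β • (X * Y - Y * X - ε • (X * P - Y * P)) + (K * X * Y - Y * X * K) = 0) ↔
      X * Y - Y * X = (K - ε • P) * X - X * (K - ε • P) ∧
        K * (X + Y) = (X + Y) * K ∧
        K * (Y * X - β • X) = (X * Y - β • X) * K := by
  have hKP : K * P = P * K := by
    calc K * P = P * P * (K * P) := by rw [hP, one_mul]
      _ = P * (P * K * P) := by simp only [mul_assoc]
      _ = P * K := by rw [hPK]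
  have hconj (Z W : S) (h : P * Z = W * P) : Z = 0 ↔ W = 0 := by
    constructor <;> rintro rfl
    · rw [← mul_one W, ← hP, ← mul_assoc, ← h, mul_zero, zero_mul]
    · rw [← one_mul Z, ← hP, mul_assoc, h, zero_mul, mul_zero]
  have hPX' (Z : S) : P * (X * Z) = Y * (P * Z) := by rw [← mul_assoc, hPX, mul_assoc]
  have hPY' (Z : S) : P * (Y * Z) = X * (P * Z) := by rw [← mul_assoc, hPY, mul_assoc]
  have hPK' (Z : S) : P * (K * Z) = K * (P * Z) := by rw [← mul_assoc, ← hKP, mul_assoc]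
  have hswap : K * X * Y - Y * X * K - β • (K * Y - Y * K) = 0 ↔
      K * Y * X - X * Y * K - β • (K * X - X * K) = 0 := by
    apply hconj
    simp only [mul_sub, sub_mul, smul_mul_assoc, mul_smul_comm, mul_assoc, hPY, hPX', hPY',
      hPK', ← hKP]
  have hcomm (h : K * (X + Y) - (X + Y) * K = 0) : K * Y - Y * K = -(K * X - X * K) := by
    rw [mul_add, add_mul] at h
    linear_combination (norm := module) h
  constructor
  · rintro ⟨h₁, h₂, h₃⟩
    have h₄ : K * X * Y - Y * X * K - β • (K * Y - Y * K) = 0 := by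
      linear_combination (norm := module) h₃ - β • h₁
    refine ⟨?_, sub_eq_zero.mp h₂, ?_⟩
    · simp only [mul_sub, sub_mul, smul_mul_assoc, mul_smul_comm, hPX]
      linear_combination (norm := module) h₁ - hcomm h₂
    · have h₅ := hswap.mp h₄
      simp only [mul_sub, sub_mul, smul_mul_assoc, mul_smul_comm, ← mul_assoc]
      linear_combination (norm := module) h₅
  · rintro ⟨h₁, h₂, h₃⟩
    have h₂' := sub_eq_zero.mpr h₂
    have h₄ : K * Y * X - X * Y * K - β • (K * X - X * K) = 0 := by
      simp only [mul_sub, sub_mul, smul_mul_assoc, mul_smul_comm, ← mul_assoc] at h₃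
      linear_combination (norm := module) h₃
    have h₅ := hswap.mpr h₄
    have h₆ : X * Y - Y * X - ε • (X * P - Y * P) + (K * Y - Y * K) = 0 := by
      simp only [mul_sub, sub_mul, smul_mul_assoc, mul_smul_comm, hPX] at h₁
      linear_combination (norm := module) h₁ + hcomm h₂'
    exact ⟨h₆, h₂', by linear_combination (norm := module) h₅ + β • h₆⟩

/-- The RLL relation of a linear L-operator is equivalent to commutation relations, in any
complex algebra where conjugation by the involution `P` exchanges `X` and `Y` and fixes `K`. -/
theorem linear_RLL_iff (hP : P * P = 1) (hPX : P * X = Y * P) (hPK : P * K * P = K)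
    (ε β α : ℂ) :
    (∀ u v : ℂ,
        (((u - v) * (u - v + β)) • (1 : S) - (ε * (u - v + β)) • P + (u - v) • K) *
            ((u + α) • (1 : S) + X) * ((v + α) • (1 : S) + Y) =
          ((v + α) • (1 : S) + Y) * ((u + α) • (1 : S) + X) *
            (((u - v) * (u - v + β)) • (1 : S) - (ε * (u - v + β)) • P + (u - v) • K)) ↔
      X * Y - Y * X = (K - ε • P) * X - X * (K - ε • P) ∧
        K * (X + Y) = (X + Y) * K ∧
        K * (Y * X - β • X) = (X * Y - β • X) * K := by
  have hPY : P * Y = X * P := by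
    rw [← mul_one (P * Y), ← hP, mul_assoc P, ← mul_assoc Y, ← hPX, ← mul_assoc, ← mul_assoc, hP,
      one_mul]
  rw [← linear_RLL_coeff_iff hP hPX hPY hPK, ← forall_smul_eq_zero_iff]
  constructor
  · intro h w b
    rw [← linear_RLL_defect hPX hPY, sub_eq_zero]
    have h' := h (b - α + w) (b - α)
    rwa [show b - α + w - (b - α) = w by ring, show b - α + w + α = b + w by ring,
      sub_add_cancel] at h'
  · intro h u v
    have h' := h (u - v) (v + α)
    rw [← linear_RLL_defect hPX hPY, sub_eq_zero] at h'
    rwa [show v + α + (u - v) = u + α by ring] at h'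

end Abstract

/-- A linear L-operator L(u) = (u+α)·Id + G satisfies the graded RLL relation with the
fundamental osp R-matrix if and only if G obeys the osp commutation relations together
with the two K-conditions. -/
theorem linear_L_RLL_iff
    (n : ℕ) (p : Fin n → ZMod 2) (ε : ℂ) (hε : ε = 1 ∨ ε = -1)
    (εlo εhi : Matrix (Fin n) (Fin n) ℂ)
    (hlo0 : ∀ a b, p a + p b ≠ 0 → εlo a b = 0)
    (hhi0 : ∀ a b, p a + p b ≠ 0 → εhi a b = 0)
    (hlosym : ∀ a b, εlo a b = ε * sg (p a * p b) * εlo b a)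
    (hhisym : ∀ a b, εhi a b = ε * sg (p a * p b) * εhi b a)
    (hinv1 : ∀ a c, (∑ b, εhi a b * εlo b c) = if a = c then 1 else 0)
    (hinv2 : ∀ a c, (∑ b, εlo a b * εhi b c) = if a = c then 1 else 0)
    (A : Type*) [Ring A] [Algebra ℂ A]
    (G : Matrix (Fin n) (Fin n) A) (α : ℂ) :
    let ω : ℂ := ∑ a, ∑ b, εhi a b * εlo a b
    let β : ℂ := 1 - ω / 2
    let PA : Matrix (Fin n × Fin n) (Fin n × Fin n) A :=
      Matrix.of fun a b => algebraMap ℂ A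
        (sg (p a.1 * p a.2) * (if a.1 = b.2 then 1 else 0) * (if a.2 = b.1 then 1 else 0))
    let KA : Matrix (Fin n × Fin n) (Fin n × Fin n) A :=
      Matrix.of fun a b => algebraMap ℂ A (εhi a.1 a.2 * εlo b.1 b.2)
    let SgA : Matrix (Fin n × Fin n) (Fin n × Fin n) A :=
      Matrix.of fun a b => algebraMap ℂ A (sg (p a.1 * p a.2) * (if a = b then 1 else 0))
    let RA : ℂ → Matrix (Fin n × Fin n) (Fin n × Fin n) A := fun u =>
      (u * (u + β)) • (1 : Matrix (Fin n × Fin n) (Fin n × Fin n) A) -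
        (ε * (u + β)) • PA + u • KA
    let M1 : Matrix (Fin n) (Fin n) A → Matrix (Fin n × Fin n) (Fin n × Fin n) A := fun X =>
      Matrix.of fun a b => if a.2 = b.2 then X a.1 b.1 else 0
    let M2 : Matrix (Fin n) (Fin n) A → Matrix (Fin n × Fin n) (Fin n × Fin n) A := fun X =>
      Matrix.of fun a b => if a.1 = b.1 then X a.2 b.2 else 0
    let L : ℂ → Matrix (Fin n) (Fin n) A := fun u =>
      (u + α) • (1 : Matrix (Fin n) (Fin n) A) + G
    let G2t : Matrix (Fin n × Fin n) (Fin n × Fin n) A := SgA * M2 G * SgA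
    (∀ u v : ℂ,
        RA (u - v) * M1 (L u) * (SgA * M2 (L v) * SgA) =
          (SgA * M2 (L v) * SgA) * M1 (L u) * RA (u - v)) ↔
      (M1 G * G2t - G2t * M1 G = (KA - ε • PA) * M1 G - M1 G * (KA - ε • PA)) ∧
      (KA * (M1 G + G2t) = (M1 G + G2t) * KA) ∧
      (KA * (G2t * M1 G - β • M1 G) = (M1 G * G2t - β • M1 G) * KA) := by
  intro ω β PA KA SgA RA M1 M2 L G2t
  have hεε : ε * ε = 1 := by rcases hε with rfl | rfl <;> norm_num
  have hPA (Z : Matrix (Fin n × Fin n) (Fin n × Fin n) A) (a b) :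
      (PA * Z) a b = sg (p a.1 * p a.2) • Z (a.2, a.1) b := by
    rw [Matrix.mul_apply, Finset.sum_eq_single (a.2, a.1)]
    · simp [PA, Algebra.smul_def]
    · rintro ⟨c, d⟩ - hcd
      have h : ¬(a.1 = d ∧ a.2 = c) := fun h => hcd (by rw [h.1, h.2])
      rcases not_and_or.mp h with h | h <;> simp [PA, h]
    · simp
  have hAP (Z : Matrix (Fin n × Fin n) (Fin n × Fin n) A) (a b) :
      (Z * PA) a b = sg (p b.1 * p b.2) • Z a (b.2, b.1) := by
    rw [Matrix.mul_apply, Finset.sum_eq_single (b.2, b.1)]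
    · simp [PA, Algebra.smul_def, Algebra.commutes, mul_comm (p b.2)]
    · rintro ⟨c, d⟩ - hcd
      have h : ¬(c = b.2 ∧ d = b.1) := fun h => hcd (by rw [h.1, h.2])
      rcases not_and_or.mp h with h | h <;> simp [PA, h]
    · simp
  have hSg : SgA = Matrix.diagonal fun a => algebraMap ℂ A (sg (p a.1 * p a.2)) := by
    ext a b
    by_cases h : a = b <;> simp [SgA, h]
  have hSgSg : SgA * SgA = 1 := by
    rw [hSg, Matrix.diagonal_mul_diagonal]
    simp only [← map_mul, sg_mul_self, map_one, Matrix.diagonal_one]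
  have hG2t (a b) : G2t a b = if a.1 = b.1 then
      (sg (p a.1 * p a.2) * sg (p b.1 * p b.2)) • G a.2 b.2 else 0 := by
    simp only [G2t, hSg, Matrix.mul_diagonal, Matrix.diagonal_mul, M2, Matrix.of_apply]
    split_ifs
    · rw [← Algebra.commutes, ← mul_assoc, ← map_mul, ← Algebra.smul_def, mul_comm]
    · simp
  have hP : PA * PA = 1 := by
    ext a b
    rw [hPA]
    simp only [PA, Matrix.of_apply, Algebra.smul_def, ← map_mul, Matrix.one_apply, Prod.ext_iff]
    rw [mul_comm (p a.2), ← mul_assoc, ← mul_assoc, sg_mul_self]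
    by_cases h₁ : a.1 = b.1 <;> by_cases h₂ : a.2 = b.2 <;> simp [h₁, h₂]
  have hPX : PA * M1 G = G2t * PA := by
    ext a b
    rw [hPA, hAP, hG2t]
    simp only [M1, Matrix.of_apply]
    split_ifs
    · rw [smul_smul, mul_comm (p b.2), mul_left_comm, sg_mul_self, mul_one]
    · simp
  have hPK : PA * KA * PA = KA := by
    ext a b
    rw [hAP, hPA]
    simp only [KA, Matrix.of_apply, Algebra.smul_def, ← map_mul]
    congr 1
    rw [hhisym a.1 a.2, hlosym b.1 b.2]
    linear_combination (-(sg (p b.1 * p b.2) * sg (p a.1 * p a.2) * εhi a.2 a.1 * εlo b.2 b.1)) *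
      hεε
  have hM1 (u : ℂ) : M1 (L u) = (u + α) • 1 + M1 G := by
    ext a b
    by_cases h₁ : a.1 = b.1 <;> by_cases h₂ : a.2 = b.2 <;>
      simp [M1, L, Matrix.one_apply, Prod.ext_iff, h₁, h₂]
  have hM2 (v : ℂ) : M2 (L v) = (v + α) • 1 + M2 G := by
    ext a b
    by_cases h₁ : a.1 = b.1 <;> by_cases h₂ : a.2 = b.2 <;>
      simp [M2, L, Matrix.one_apply, Prod.ext_iff, h₁, h₂]
  have hL2 (v : ℂ) : SgA * M2 (L v) * SgA = (v + α) • 1 + G2t := by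
    rw [hM2, mul_add, add_mul, mul_smul_comm, smul_mul_assoc, mul_one, hSgSg]
  simp only [hL2, hM1]
  exact linear_RLL_iff hP hPX hPK ε β α
end

section
/- With a supermetric as in the context, let B be a unital associative ℂ-algebra containing two families of elements c₁^a, c₂^a (a ∈ I) such that c_i^a c_i^b + ε(−1)^{[a][b]} c_i^b c_i^a = ε̄^{ab}·1 for i = 1, 2, and c₁^a c₂^b = (−1)^{[a][b]} c₂^b c₁^a. For i = 1, 2 set F_i^{ab} := ε(−1)^{[b]}·(1/2)·(c_i^a c_i^b − ε(−1)^{[a][b]} c_i^b c_i^a). For a word (a_1,…,a_k) ∈ I^k and σ in the symmetric group S_k, let Inv(σ) := {(i,j) : i < j, σ(i) > σ(j)} and sgn_g(σ; a) := ∏_{(i,j)∈Inv(σ)} ( −ε(−1)^{[a_{σ(i)}][a_{σ(j)}]} ), and define the graded symmetrized product c_i^{(a_1}⋯c_i^{a_k)} := (1/k!)·Σ_{σ∈S_k} sgn_g(σ; a) · c_i^{a_{σ(1)}}⋯c_i^{a_{σ(k)}}. Then for every k ≥ 1, the element J_k := Σ_{a_1,…,a_k,b_1,…,b_k} ε_{a_1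 b_1}⋯ε_{a_k b_k} · c₁^{(a_1}⋯c₁^{a_k)} · c₂^{(b_k}⋯c₂^{b_1)} commutes with F₁^{ab} + F₂^{ab} for all a, b ∈ I: J_k·(F₁^{ab} + F₂^{ab}) = (F₁^{ab} + F₂^{ab})·J_k. -/
/-- The graded sign of a permutation σ acting on the word a:
the product over inversions of σ of the factors −ε(−1)^{[a_{σ(i)}][a_{σ(j)}]}. -/
noncomputable def gradedSign (n : ℕ) (p : Fin n → ZMod 2) (ε : ℂ) (k : ℕ)
    (a : Fin k → Fin n) (σ : Equiv.Perm (Fin k)) : ℂ :=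
  ∏ ij ∈ Finset.univ.filter (fun ij : Fin k × Fin k => ij.1 < ij.2 ∧ σ ij.2 < σ ij.1),
    (-ε * sg (p (a (σ ij.1)) * p (a (σ ij.2))))

/-- The graded symmetrized product c^{(a_1}⋯c^{a_k)} of a word of super-oscillators. -/
noncomputable def gradedSym {B : Type*} [Ring B] [Algebra ℂ B]
    (n : ℕ) (p : Fin n → ZMod 2) (ε : ℂ) (c : Fin n → B) (k : ℕ) (a : Fin k → Fin n) : B :=
  ((k.factorial : ℂ))⁻¹ • ∑ σ : Equiv.Perm (Fin k),
    gradedSign n p ε k a σ • (List.ofFn fun t => c (a (σ t))).prod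

/-- Graded Leibniz rule for moving `F` through a word. -/
theorem graded_leibniz_word {ι B : Type*} [Fintype ι] [Ring B] [Algebra ℂ B]
    (F : B) (c : ι → B) (s : ι → ℂ) (M : ι → ι → ℂ)
    (h : ∀ x, F * c x = s x • (c x * F) + ∑ d, M x d • c d) (k : ℕ) (w : Fin k → ι) :
    F * (List.ofFn fun t => c (w t)).prod =
      (∏ t, s (w t)) • ((List.ofFn fun t => c (w t)).prod * F) +
      ∑ t, (∏ u, if u < t then s (w u) else 1) •
        ∑ d, M (w t) d • (List.ofFn fun u => c (Function.update w t d u)).prod := by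
  induction k with
  | zero => simp
  | succ k ih =>
    have h0 : ∀ d, (fun i : Fin k => c (Function.update w 0 d i.succ)) = fun i => c (w i.succ) := by
      intro d; funext i; simp
    have h1 : ∀ (t : Fin k) d, (fun i : Fin k => c (Function.update w t.succ d i.succ)) =
        fun i => c (Function.update (fun j : Fin k => w j.succ) t d i) := by
      intro t d; funext i
      by_cases hi : i = t
      · subst hi; simp
      · simp [hi]
    have h2 : ∀ (t : Fin k) d, Function.update w t.succ d 0 = w 0 := by
      intro t d; simp [Function.update, (Fin.succ_ne_zero t).symm]
    simp only [List.ofFn_succ, List.prod_cons, Fin.sum_univ_succ, Fin.prod_univ_succ, h0, h1, h2,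
      Function.update_self, Fin.succ_lt_succ_iff, Fin.succ_pos, if_true, lt_self_iff_false,
      if_false, Fin.not_lt_zero, Finset.prod_const_one, one_mul, one_smul]
    rw [← mul_assoc, h, add_mul, smul_mul_assoc, mul_assoc, ih]
    simp only [mul_add, smul_add, Finset.sum_mul, Finset.mul_sum, smul_mul_assoc, mul_smul_comm,
      Finset.smul_sum, smul_smul, mul_assoc]
    abel

/-- Changing the parity of the letter in slot `σ t` changes the graded sign of `σ` by the
signs of the letters that `σ` moves past that slot. -/
theorem gradedSign_update (n : ℕ) (p : Fin n → ZMod 2) (ε : ℂ) (k : ℕ) (a : Fin k → Fin n)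
    (σ : Equiv.Perm (Fin k)) (π : ZMod 2) (t : Fin k) (d : Fin n) (hd : p d = p (a (σ t)) + π) :
    gradedSign n p ε k a σ * (∏ u, if u < t then sg (π * p (a (σ u))) else 1) =
      gradedSign n p ε k (Function.update a (σ t) d) σ *
        ∏ u, if u < σ t then sg (π * p (a u)) else 1 := by
  have key : gradedSign n p ε k (Function.update a (σ t) d) σ = gradedSign n p ε k a σ *
      ((∏ j, if t < j ∧ σ j < σ t then sg (π * p (a (σ j))) else 1) *
        ∏ i, if i < t ∧ σ t < σ i then sg (π * p (a (σ i))) else 1) := by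
    have e1 : (∏ j, if t < j ∧ σ j < σ t then sg (π * p (a (σ j))) else 1) =
        ∏ i, ∏ j, if i = t then (if t < j ∧ σ j < σ t then sg (π * p (a (σ j))) else 1) else 1 := by
      rw [Finset.prod_comm]
      simp
    have e2 : (∏ i, if i < t ∧ σ t < σ i then sg (π * p (a (σ i))) else 1) =
        ∏ i, ∏ j, if j = t then (if i < t ∧ σ t < σ i then sg (π * p (a (σ i))) else 1) else 1 := by
      simp
    rw [e1, e2]
    simp only [gradedSign, Finset.prod_filter, Fintype.prod_prod_type, ← Finset.prod_mul_distrib]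
    refine Finset.prod_congr rfl fun i _ => Finset.prod_congr rfl fun j _ => ?_
    by_cases hij : i < j ∧ σ j < σ i
    · by_cases hi : i = t
      · subst hi
        have hj : j ≠ i := hij.1.ne'
        simp [hij, hj, hd, add_mul, sg_add, mul_assoc]
      · by_cases hj : j = t
        · subst hj
          simp [hij, hi, hd, mul_add, sg_add, mul_assoc, mul_comm π]
        · simp [hij, hi, hj]
    · by_cases hi : i = t
      · subst hi
        by_cases hj : j = i
        · subst hj; simp
        · simp [hij, hj]
      · by_cases hj : j = t
        · subst hj; simp [hij, hi]
        · simp [hij, hi, hj]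
  rw [key, ← Equiv.prod_comp σ (fun u => if u < σ t then sg (π * p (a u)) else 1), mul_assoc,
    ← Finset.prod_mul_distrib, ← Finset.prod_mul_distrib]
  congr 1
  refine Finset.prod_congr rfl fun u _ => ?_
  rcases lt_trichotomy u t with h | h | h
  · rcases lt_or_gt_of_ne (σ.injective.ne h.ne) with h' | h'
    · simp [h, h', h.not_gt, h'.not_gt]
    · simp [h, h', h.not_gt, h'.not_gt]
  · subst h; simp
  · rcases lt_or_gt_of_ne (σ.injective.ne h.ne') with h' | h'
    · simp [h, h', h.not_gt, h'.not_gt, sg_mul_self]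
    · simp [h, h.not_gt, h'.not_gt]

/-- The graded symmetrized product obeys the same graded Leibniz rule as a plain word. -/
theorem graded_leibniz_gradedSym {B : Type*} [Ring B] [Algebra ℂ B]
    (n : ℕ) (p : Fin n → ZMod 2) (ε : ℂ) (F : B) (c : Fin n → B) (π : ZMod 2)
    (M : Fin n → Fin n → ℂ) (hM : ∀ x d, p d ≠ p x + π → M x d = 0)
    (h : ∀ x, F * c x = sg (π * p x) • (c x * F) + ∑ d, M x d • c d)
    (k : ℕ) (a : Fin k → Fin n) :
    F * gradedSym n p ε c k a =
      (∏ t, sg (π * p (a t))) • (gradedSym n p ε c k a * F) +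
      ∑ t, (∏ u, if u < t then sg (π * p (a u)) else 1) •
        ∑ d, M (a t) d • gradedSym n p ε c k (Function.update a t d) := by
  have hσ : ∀ σ : Equiv.Perm (Fin k),
      F * (gradedSign n p ε k a σ • (List.ofFn fun t => c (a (σ t))).prod) =
      (∏ t, sg (π * p (a t))) •
        ((gradedSign n p ε k a σ • (List.ofFn fun t => c (a (σ t))).prod) * F) +
      ∑ t, (∏ u, if u < t then sg (π * p (a u)) else 1) •
        ∑ d, M (a t) d • (gradedSign n p ε k (Function.update a t d) σ •
          (List.ofFn fun u => c (Function.update a t d (σ u))).prod) := by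
    intro σ
    rw [mul_smul_comm, graded_leibniz_word F c (fun x => sg (π * p x)) M h k (fun t => a (σ t)),
      smul_add, Equiv.prod_comp σ (fun t => sg (π * p (a t))), smul_mul_assoc, smul_comm]
    congr 1
    conv_rhs => rw [← Equiv.sum_comp σ]
    rw [Finset.smul_sum]
    refine Finset.sum_congr rfl fun t _ => ?_
    simp only [Finset.smul_sum, smul_smul]
    refine Finset.sum_congr rfl fun d _ => ?_
    by_cases hd : p d = p (a (σ t)) + π
    · have hw : (fun u => c (Function.update (fun t => a (σ t)) t d u)) =
          fun u => c (Function.update a (σ t) d (σ u)) := by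
        funext u
        by_cases hu : u = t
        · subst hu; simp
        · simp [hu]
      rw [hw]
      congr 1
      linear_combination M (a (σ t)) d * gradedSign_update n p ε k a σ π t d hd
    · simp [hM _ _ hd]
  simp only [gradedSym]
  rw [mul_smul_comm, Finset.mul_sum, Finset.sum_congr rfl fun σ _ => hσ σ, Finset.sum_add_distrib,
    smul_add, ← Finset.smul_sum, ← Finset.sum_mul, smul_comm, smul_mul_assoc]
  congr 1
  rw [Finset.sum_comm, Finset.smul_sum]
  refine Finset.sum_congr rfl fun t _ => ?_
  rw [← Finset.smul_sum, smul_comm, Finset.sum_comm, Finset.smul_sum]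
  congr 1
  refine Finset.sum_congr rfl fun d _ => ?_
  rw [← Finset.smul_sum, smul_comm]

theorem sum_update_swap {ι κ B : Type*} [Fintype ι] [Fintype κ] [DecidableEq κ]
    [AddCommMonoid B] (t : κ) (Φ : (κ → ι) → (κ → ι) → B) :
    ∑ a, ∑ d, Φ a (Function.update a t d) = ∑ a, ∑ d, Φ (Function.update a t d) a := by
  rw [← Fintype.sum_prod_type', ← Fintype.sum_prod_type']
  refine Finset.sum_nbij' (fun x => (Function.update x.1 t x.2, x.1 t))
    (fun x => (Function.update x.1 t x.2, x.1 t)) ?_ ?_ ?_ ?_ ?_ <;> simp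

/-- A contraction of two tensors by an invariant bilinear form `g` is invariant. -/
theorem contraction_commute {ι B : Type*} [Fintype ι] [DecidableEq ι] [Ring B] [Algebra ℂ B]
    (F : B) (s : ι → ℂ) (M g : ι → ι → ℂ) (hs : ∀ x, s x * s x = 1)
    (hgs : ∀ x y, g x y * s x = g x y * s y)
    (hinv : ∀ e f, ∑ d, (g d f * M d e + s e * g e d * M d f) = 0)
    (k : ℕ) (S T : (Fin k → ι) → B)
    (hS : ∀ a, F * S a = (∏ t, s (a t)) • (S a * F) +
      ∑ t, (∏ u, if u < t then s (a u) else 1) • ∑ d, M (a t) d • S (Function.update a t d))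
    (hT : ∀ a, F * T a = (∏ t, s (a t)) • (T a * F) +
      ∑ t, (∏ u, if u < t then s (a u) else 1) • ∑ d, M (a t) d • T (Function.update a t d)) :
    (∑ a : Fin k → ι, ∑ b : Fin k → ι, (∏ t, g (a t) (b t)) • (S a * T fun t => b t.rev)) * F =
      F * ∑ a : Fin k → ι, ∑ b : Fin k → ι, (∏ t, g (a t) (b t)) • (S a * T fun t => b t.rev) := by
  set G : (Fin k → ι) → (Fin k → ι) → B := fun a b => S a * T fun t => b t.rev with hG
  have hT' : ∀ b : Fin k → ι, F * T (fun t => b t.rev) =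
      (∏ t, s (b t)) • (T (fun t => b t.rev) * F) +
      ∑ t, (∏ u, if t < u then s (b u) else 1) •
        ∑ d, M (b t) d • T (fun u => Function.update b t d u.rev) := by
    intro b
    rw [hT, ← Equiv.prod_comp Fin.revPerm (fun t => s (b t)), ← Equiv.sum_comp Fin.revPerm]
    congr 1
    refine Finset.sum_congr rfl fun t _ => ?_
    rw [← Equiv.prod_comp Fin.revPerm]
    simp only [Fin.revPerm_apply, Fin.rev_lt_rev, Fin.rev_rev]
    congr 1
    refine Finset.sum_congr rfl fun d _ => ?_
    congr 2
    funext u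
    by_cases hu : u = t.rev
    · subst hu; simp
    · have : u.rev ≠ t := fun h => hu (by rw [← h, Fin.rev_rev])
      simp [hu, this]
  have hFG : ∀ a b, F * ((∏ t, g (a t) (b t)) • G a b) = (∏ t, g (a t) (b t)) • (G a b * F) +
      ∑ t, ∑ d, (((∏ t, g (a t) (b t)) * (∏ u, if u < t then s (a u) else 1) * M (a t) d) •
          G (Function.update a t d) b +
        ((∏ t, g (a t) (b t)) * ((∏ u, s (a u)) * ∏ u, if t < u then s (b u) else 1) *
          M (b t) d) • G a (Function.update b t d)) := by
    intro a b
    have h1 : (∏ t, g (a t) (b t)) * (∏ t, s (a t)) * ∏ t, s (b t) = ∏ t, g (a t) (b t) := by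
      rw [mul_assoc, ← Finset.prod_mul_distrib, ← Finset.prod_mul_distrib]
      refine Finset.prod_congr rfl fun u _ => ?_
      rw [← mul_assoc, hgs, mul_assoc, hs, mul_one]
    simp only [hG]
    rw [mul_smul_comm, ← mul_assoc, hS, add_mul, smul_mul_assoc, mul_assoc, hT', mul_add,
      mul_smul_comm, smul_add, smul_add, smul_add, smul_smul, smul_smul, h1, mul_assoc (S a), add_assoc]
    congr 1
    simp only [Finset.sum_add_distrib, Finset.smul_sum, Finset.sum_mul, Finset.mul_sum,
      smul_mul_assoc, mul_smul_comm, smul_smul, mul_assoc]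
    rw [add_comm]
  change (∑ a, ∑ b, (∏ t, g (a t) (b t)) • G a b) * F =
    F * ∑ a, ∑ b, (∏ t, g (a t) (b t)) • G a b
  simp only [Finset.sum_mul, Finset.mul_sum, hFG, smul_mul_assoc, Finset.sum_add_distrib]
  refine left_eq_add.mpr ?_
  have hA : ∀ t : Fin k, ∑ a : Fin k → ι, ∑ b : Fin k → ι, ∑ d,
      ((∏ t, g (a t) (b t)) * (∏ u, if u < t then s (a u) else 1) * M (a t) d) •
          G (Function.update a t d) b =
      ∑ a : Fin k → ι, ∑ b : Fin k → ι, ∑ d,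
        (((∏ u, if u = t then 1 else g (a u) (b u)) * ∏ u, if u < t then s (a u) else 1) *
          (g d (b t) * M d (a t))) • G a b := by
    intro t
    rw [Finset.sum_comm]
    conv_rhs => rw [Finset.sum_comm]
    refine Finset.sum_congr rfl fun b _ => ?_
    have := sum_update_swap t (fun a a' : Fin k → ι =>
      ((∏ t, g (a t) (b t)) * (∏ u, if u < t then s (a u) else 1) * M (a t) (a' t)) • G a' b)
    simp only [Function.update_self] at this
    rw [this]
    refine Finset.sum_congr rfl fun a _ => Finset.sum_congr rfl fun d _ => ?_
    have h1 : (∏ u, g (Function.update a t d u) (b u)) =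
        g d (b t) * ∏ u, if u = t then 1 else g (a u) (b u) := by
      have : g d (b t) = ∏ u, if u = t then g d (b u) else 1 := by simp
      rw [this, ← Finset.prod_mul_distrib]
      refine Finset.prod_congr rfl fun u _ => ?_
      by_cases hu : u = t
      · subst hu; simp
      · simp [hu]
    have h2 : (∏ u, if u < t then s (Function.update a t d u) else 1) =
        ∏ u, if u < t then s (a u) else 1 := by
      refine Finset.prod_congr rfl fun u _ => ?_
      by_cases hu : u = t
      · subst hu; simp
      · simp [hu]
    rw [h1, h2]
    congr 1
    ring
  have hB : ∀ t : Fin k, ∑ a : Fin k → ι, ∑ b : Fin k → ι, ∑ d,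
      ((∏ t, g (a t) (b t)) * ((∏ u, s (a u)) * ∏ u, if t < u then s (b u) else 1) *
          M (b t) d) • G a (Function.update b t d) =
      ∑ a : Fin k → ι, ∑ b : Fin k → ι, ∑ d,
        (((∏ u, if u = t then 1 else g (a u) (b u)) * ∏ u, if u < t then s (a u) else 1) *
          (s (a t) * g (a t) d * M d (b t))) • G a b := by
    intro t
    refine Finset.sum_congr rfl fun a _ => ?_
    have := sum_update_swap t (fun b b' : Fin k → ι =>
      ((∏ t, g (a t) (b t)) * ((∏ u, s (a u)) * ∏ u, if t < u then s (b u) else 1) *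
          M (b t) (b' t)) • G a b')
    simp only [Function.update_self] at this
    rw [this]
    refine Finset.sum_congr rfl fun b _ => Finset.sum_congr rfl fun d _ => ?_
    have h1 : (∏ u, g (a u) (Function.update b t d u)) *
          ((∏ u, s (a u)) * ∏ u, if t < u then s (Function.update b t d u) else 1) =
        g (a t) d * s (a t) * ((∏ u, if u = t then 1 else g (a u) (b u)) *
          ∏ u, if u < t then s (a u) else 1) := by
      have : g (a t) d * s (a t) = ∏ u, if u = t then g (a u) d * s (a u) else 1 := by simp
      rw [this]
      simp only [← Finset.prod_mul_distrib]
      refine Finset.prod_congr rfl fun u _ => ?_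
      rcases lt_trichotomy u t with hu | hu | hu
      · simp [hu, hu.ne, hu.not_gt]
      · subst hu; simp
      · have h3 : g (a u) (b u) * (s (a u) * s (b u)) = g (a u) (b u) := by
          rw [← mul_assoc, hgs, mul_assoc, hs, mul_one]
        simp [hu, hu.ne', hu.not_gt, h3]
    rw [h1]
    congr 1
    ring
  have hC : ∀ t : Fin k, ∑ a : Fin k → ι, ∑ b : Fin k → ι, ∑ d,
      (((∏ t, g (a t) (b t)) * (∏ u, if u < t then s (a u) else 1) * M (a t) d) •
          G (Function.update a t d) b +
        ((∏ t, g (a t) (b t)) * ((∏ u, s (a u)) * ∏ u, if t < u then s (b u) else 1) *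
          M (b t) d) • G a (Function.update b t d)) = 0 := by
    intro t
    simp only [Finset.sum_add_distrib]
    rw [hA, hB]
    simp only [← Finset.sum_add_distrib, ← add_smul, ← mul_add, ← Finset.sum_smul,
      ← Finset.mul_sum, hinv]
    simp
  have hsum : ∑ t : Fin k, ∑ a : Fin k → ι, ∑ b : Fin k → ι, ∑ d,
      (((∏ t, g (a t) (b t)) * (∏ u, if u < t then s (a u) else 1) * M (a t) d) •
          G (Function.update a t d) b +
        ((∏ t, g (a t) (b t)) * ((∏ u, s (a u)) * ∏ u, if t < u then s (b u) else 1) *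
          M (b t) d) • G a (Function.update b t d)) = 0 :=
    Finset.sum_eq_zero fun t _ => hC t
  rw [Finset.sum_comm] at hsum
  simp_rw [Finset.sum_comm (s := (Finset.univ : Finset (Fin k)))
    (t := (Finset.univ : Finset (Fin k → ι)))] at hsum
  simpa only [Finset.sum_add_distrib] using hsum

/-- Graded commutator of a quadratic expression with a super-oscillator. -/
theorem quadratic_mul_oscillator {ι B : Type*} [Fintype ι] [DecidableEq ι] [Ring B] [Algebra ℂ B]
    (p : ι → ZMod 2) (ε : ℂ) (hε : ε * ε = 1) (h : ι → ι → ℂ)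
    (h0 : ∀ a b, p a + p b ≠ 0 → h a b = 0) (c : ι → B)
    (hosc : ∀ a b, c a * c b + (ε * sg (p a * p b)) • (c b * c a) = h a b • (1 : B))
    (κ : ℂ) (a b x : ι) :
    ((κ * (1 / 2 : ℂ)) • (c a * c b - (ε * sg (p a * p b)) • (c b * c a))) * c x =
      sg ((p a + p b) * p x) •
        (c x * ((κ * (1 / 2 : ℂ)) • (c a * c b - (ε * sg (p a * p b)) • (c b * c a)))) +
      ∑ d, (κ * ((if d = a then h b x else 0) -
        (if d = b then ε * sg (p b * p x) * h a x else 0))) • c d := by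
  have e1 : (κ * (1 / 2 : ℂ)) • (c a * c b - (ε * sg (p a * p b)) • (c b * c a)) =
      κ • (c a * c b) - (κ * (1 / 2) * h a b) • (1 : B) := by
    rw [mul_smul _ (h a b), ← hosc]
    module
  have e2 : c a * c b * c x = h b x • c a - (ε * sg (p b * p x) * h a x) • c b +
      sg ((p a + p b) * p x) • (c x * (c a * c b)) := by
    have hb : c b * c x = h b x • (1 : B) - (ε * sg (p b * p x)) • (c x * c b) :=
      eq_sub_of_add_eq (hosc b x)
    have ha : c a * c x = h a x • (1 : B) - (ε * sg (p a * p x)) • (c x * c a) :=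
      eq_sub_of_add_eq (hosc a x)
    rw [mul_assoc, hb, mul_sub, mul_smul_comm, mul_smul_comm, mul_one, ← mul_assoc, ha, sub_mul,
      smul_mul_assoc, smul_mul_assoc, one_mul, smul_sub, smul_smul, smul_smul, add_mul, sg_add,
      mul_assoc (c x)]
    have : ε * sg (p b * p x) * (ε * sg (p a * p x)) = sg (p a * p x) * sg (p b * p x) := by
      linear_combination sg (p b * p x) * sg (p a * p x) * hε
    rw [this]
    abel
  have e3 : sg ((p a + p b) * p x) * h a b = h a b := by
    by_cases hp : p a + p b = 0
    · simp [hp, sg]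
    · simp [h0 a b hp]
  rw [e1, sub_mul, smul_mul_assoc, e2, mul_sub, mul_smul_comm, smul_sub, mul_smul_comm, mul_one,
    smul_mul_assoc, one_mul, smul_smul _ _ (c x),
    show sg ((p a + p b) * p x) * (κ * (1 / 2) * h a b) = κ * (1 / 2) * h a b by
      linear_combination κ * (1 / 2) * e3]
  have e4 : ∑ d, (κ * ((if d = a then h b x else 0) -
        (if d = b then ε * sg (p b * p x) * h a x else 0))) • c d =
      (κ * h b x) • c a - (κ * (ε * sg (p b * p x) * h a x)) • c b := by
    simp [mul_sub, sub_smul, Finset.sum_sub_distrib]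
  rw [e4]
  module

/-- A quadratic expression in one family graded-commutes with the other family. -/
theorem quadratic_mul_graded {ι B : Type*} [Ring B] [Algebra ℂ B]
    (p : ι → ZMod 2) (c c' : ι → B)
    (hcross : ∀ a b, c a * c' b = sg (p a * p b) • (c' b * c a)) (κ η : ℂ) (a b x : ι) :
    (κ • (c a * c b - η • (c b * c a))) * c' x =
      sg ((p a + p b) * p x) • (c' x * (κ • (c a * c b - η • (c b * c a)))) := by
  have e : ∀ a b, c a * c b * c' x = sg ((p a + p b) * p x) • (c' x * (c a * c b)) := by
    intro a b
    rw [mul_assoc, hcross, mul_smul_comm, ← mul_assoc, hcross, smul_mul_assoc, smul_smul, mul_assoc,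
      add_mul, sg_add, mul_comm (sg _)]
  rw [smul_mul_assoc, sub_mul, smul_mul_assoc, e a b, e b a, add_comm (p b), mul_smul_comm,
    mul_sub, mul_smul_comm]
  module

/-- The matrices of the osp generators preserve the supermetric. -/
theorem supermetric_invariant {ι : Type*} [Fintype ι] [DecidableEq ι]
    (p : ι → ZMod 2) (ε : ℂ) (hε : ε * ε = 1) (lo hi : ι → ι → ℂ)
    (hhi0 : ∀ a b, p a + p b ≠ 0 → hi a b = 0)
    (hhisym : ∀ a b, hi a b = ε * sg (p a * p b) * hi b a)
    (hinv1 : ∀ a c, (∑ b, hi a b * lo b c) = if a = c then 1 else 0)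
    (hinv2 : ∀ a c, (∑ b, lo a b * hi b c) = if a = c then 1 else 0)
    (κ : ℂ) (a b e f : ι) :
    ∑ d, (lo d f * (κ * ((if e = a then hi b d else 0) -
        (if e = b then ε * sg (p b * p d) * hi a d else 0))) +
      sg ((p a + p b) * p e) * lo e d * (κ * ((if f = a then hi b d else 0) -
        (if f = b then ε * sg (p b * p d) * hi a d else 0)))) = 0 := by
  have hp : ∀ x d, hi x d ≠ 0 → p d = p x := by
    intro x d hx
    have h1 : p x + p d = 0 := by
      by_contra h
      exact hx (hhi0 _ _ h)
    rw [← CharTwo.sub_eq_add] at h1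
    exact (sub_eq_zero.mp h1).symm
  have r1 : ∀ x y d, sg (p y * p d) * hi x d = sg (p y * p x) * hi x d := by
    intro x y d
    by_cases hx : hi x d = 0
    · simp [hx]
    · rw [hp x d hx]
  have r2 : ∀ x d, hi x d = ε * sg (p x * p x) * hi d x := by
    intro x d
    by_cases hx : hi x d = 0
    · have h1 : hi d x = 0 := by rw [hhisym, hx, mul_zero]
      rw [hx, h1, mul_zero]
    · rw [hhisym x d, hp x d hx]
  have t : ∀ d, lo d f * (κ * ((if e = a then hi b d else 0) -
        (if e = b then ε * sg (p b * p d) * hi a d else 0))) +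
      sg ((p a + p b) * p e) * lo e d * (κ * ((if f = a then hi b d else 0) -
        (if f = b then ε * sg (p b * p d) * hi a d else 0))) =
      κ * (if e = a then 1 else 0) * (hi b d * lo d f) -
      κ * ((if e = b then 1 else 0) * (ε * sg (p b * p a))) * (hi a d * lo d f) +
      κ * (sg ((p a + p b) * p e) * (if f = a then 1 else 0) * (ε * sg (p b * p b))) *
        (lo e d * hi d b) -
      κ * (sg ((p a + p b) * p e) * (if f = b then 1 else 0) * (sg (p b * p a) * sg (p a * p a))) *
        (lo e d * hi d a) := by
    intro d
    simp only [mul_assoc ε, r1]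
    have q1 := r2 a d
    have q2 := r2 b d
    have q3 : ε * (sg (p b * p a) * hi a d) = sg (p b * p a) * sg (p a * p a) * hi d a := by
      linear_combination ε * sg (p b * p a) * q1 +
        sg (p b * p a) * sg (p a * p a) * hi d a * hε
    rw [← boole_mul (e = a), ← boole_mul (e = b), ← boole_mul (f = a), ← boole_mul (f = b)]
    linear_combination (if f = a then 1 else 0) * sg ((p a + p b) * p e) * lo e d * κ * q2
      - (if f = b then 1 else 0) * sg ((p a + p b) * p e) * lo e d * κ * q3
  rw [Finset.sum_congr rfl fun d _ => t d]
  simp only [Finset.sum_add_distrib, Finset.sum_sub_distrib, ← Finset.mul_sum, hinv1, hinv2]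
  have u1 := sg_mul_self (p a * p a)
  have u2 := sg_mul_self (p b * p b)
  have u3 := sg_mul_self (p a * p b)
  have w1 : (if e = a then (1 : ℂ) else 0) * sg ((p a + p b) * p e) =
      (if e = a then 1 else 0) * (sg (p a * p a) * sg (p a * p b)) := by
    split_ifs with h
    · rw [h, add_mul, sg_add, mul_comm (p b)]
    · simp
  have w2 : (if e = b then (1 : ℂ) else 0) * sg ((p a + p b) * p e) =
      (if e = b then 1 else 0) * (sg (p a * p b) * sg (p b * p b)) := by
    split_ifs with h
    · rw [h, add_mul, sg_add]
    · simp
  rw [mul_comm (p b) (p a)]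
  simp only [eq_comm (a := b) (b := f), eq_comm (a := a) (b := f)]
  linear_combination κ * (if f = a then 1 else 0) * (ε * sg (p b * p b)) * w2
    - κ * (if f = b then 1 else 0) * (sg (p a * p b) * sg (p a * p a)) * w1
    + κ * (if f = a then 1 else 0) * (if e = b then 1 else 0) * ε * sg (p a * p b) * u2
    - κ * (if f = b then 1 else 0) * (if e = a then 1 else 0) *
      (sg (p a * p b) * sg (p a * p b) * u1 + u3)

/-- The osp-invariant elements J_k = ε_{a_1b_1}⋯ε_{a_kb_k} c₁^{(a_1⋯a_k)} c₂^{(b_k⋯b_1)}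
commute with the total osp generators F₁^{ab} + F₂^{ab}. -/
theorem graded_symmetrized_invariants_commute
    (n : ℕ) (p : Fin n → ZMod 2) (ε : ℂ) (hε : ε = 1 ∨ ε = -1)
    (εlo εhi : Matrix (Fin n) (Fin n) ℂ)
    (hlo0 : ∀ a b, p a + p b ≠ 0 → εlo a b = 0)
    (hhi0 : ∀ a b, p a + p b ≠ 0 → εhi a b = 0)
    (hlosym : ∀ a b, εlo a b = ε * sg (p a * p b) * εlo b a)
    (hhisym : ∀ a b, εhi a b = ε * sg (p a * p b) * εhi b a)
    (hinv1 : ∀ a c, (∑ b, εhi a b * εlo b c) = if a = c then 1 else 0)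
    (hinv2 : ∀ a c, (∑ b, εlo a b * εhi b c) = if a = c then 1 else 0)
    (B : Type*) [Ring B] [Algebra ℂ B] (c1 c2 : Fin n → B)
    (hosc1 : ∀ a b, c1 a * c1 b + (ε * sg (p a * p b)) • (c1 b * c1 a) = εhi a b • (1 : B))
    (hosc2 : ∀ a b, c2 a * c2 b + (ε * sg (p a * p b)) • (c2 b * c2 a) = εhi a b • (1 : B))
    (hcross : ∀ a b, c1 a * c2 b = sg (p a * p b) • (c2 b * c1 a)) :
    let F1 : Fin n → Fin n → B := fun a b =>
      (ε * sg (p b) * (1 / 2 : ℂ)) • (c1 a * c1 b - (ε * sg (p a * p b)) • (c1 b * c1 a))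
    let F2 : Fin n → Fin n → B := fun a b =>
      (ε * sg (p b) * (1 / 2 : ℂ)) • (c2 a * c2 b - (ε * sg (p a * p b)) • (c2 b * c2 a))
    let J : ℕ → B := fun k =>
      ∑ a : Fin k → Fin n, ∑ b : Fin k → Fin n,
        (∏ t, εlo (a t) (b t)) •
          (gradedSym n p ε c1 k a * gradedSym n p ε c2 k (fun t => b t.rev))
    ∀ k : ℕ, 1 ≤ k → ∀ a b : Fin n,
      J k * (F1 a b + F2 a b) = (F1 a b + F2 a b) * J k := by
  intro F1 F2 J k _ a b
  have hεε : ε * ε = 1 := by rcases hε with h | h <;> rw [h] <;> norm_num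
  have hpar : ∀ x y, p x + p y = 0 → p x = p y := by
    intro x y h
    rwa [← CharTwo.sub_eq_add, sub_eq_zero] at h
  have hcross' : ∀ a b, c2 a * c1 b = sg (p a * p b) • (c1 b * c2 a) := by
    intro a b
    rw [hcross, smul_smul, mul_comm (p a), sg_mul_self, one_smul]
  have hF1 : ∀ x, (F1 a b + F2 a b) * c1 x = _ := fun x => by
    rw [add_mul, quadratic_mul_oscillator p ε hεε εhi hhi0 c1 hosc1 (ε * sg (p b)) a b x,
      quadratic_mul_graded p c2 c1 hcross', add_right_comm, ← smul_add, ← mul_add]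
  have hF2 : ∀ x, (F1 a b + F2 a b) * c2 x = _ := fun x => by
    rw [add_mul, quadratic_mul_oscillator p ε hεε εhi hhi0 c2 hosc2 (ε * sg (p b)) a b x,
      quadratic_mul_graded p c1 c2 hcross, ← add_assoc, ← smul_add, ← mul_add]
  have hM : ∀ x d, p d ≠ p x + (p a + p b) → ε * sg (p b) * ((if d = a then εhi b x else 0) -
      (if d = b then ε * sg (p b * p x) * εhi a x else 0)) = 0 := by
    intro x d hd
    have h1 : (if d = a then εhi b x else 0) = 0 := by
      split_ifs with h
      · by_contra h'
        have := hpar b x (by_contra fun hh => h' (hhi0 _ _ hh))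
        apply hd
        rw [h, ← this, add_comm (p a), ← add_assoc, CharTwo.add_self_eq_zero, zero_add]
      · rfl
    have h2 : (if d = b then ε * sg (p b * p x) * εhi a x else 0) = 0 := by
      split_ifs with h
      · by_contra h'
        have := hpar a x (by_contra fun hh => h' (by rw [hhi0 _ _ hh, mul_zero]))
        apply hd
        rw [h, ← this, ← add_assoc, CharTwo.add_self_eq_zero, zero_add]
      · rfl
    rw [h1, h2, sub_zero, mul_zero]
  refine contraction_commute (F1 a b + F2 a b) (fun x => sg ((p a + p b) * p x))
    (fun x d => ε * sg (p b) * ((if d = a then εhi b x else 0) -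
      (if d = b then ε * sg (p b * p x) * εhi a x else 0))) εlo (fun x => sg_mul_self _) ?_
    (supermetric_invariant p ε hεε εlo εhi hhi0 hhisym hinv1 hinv2 (ε * sg (p b)) a b) k _ _
    (graded_leibniz_gradedSym n p ε _ c1 (p a + p b) _ hM hF1 k)
    (graded_leibniz_gradedSym n p ε _ c2 (p a + p b) _ hM hF2 k)
  intro x y
  by_cases h : p x + p y = 0
  · simp only [hpar x y h]
  · rw [hlo0 x y h, zero_mul, zero_mul]
end
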